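/- arXiv:2410.06378 — 2 statements merged into one kernel-verified Lean document; each statement's English description precedes it below -/
import Mathlib

section
/- There exists an absolute constant c ∈ ℝ_+ such that for every p ∈ [1,∞], all d, W, L ∈ ℕ with W ≥ d and W, L ≥ 60, every B ∈ ℝ_+ with B ≥ 1, and every finite set 𝔸 ⊆ ℝ with |𝔸| ≥ 2, the worst-case quantization error satisfies A(R(d,W,L,B), R_𝔸(d,W,L), ‖·‖_{L^p([0,1]^d)}) ≥ min{ 1/8, (W+1)^L B^L 2^{−c·log(|𝔸|)} }. -/
open MeasureTheory ProbabilityTheory ENNReal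

noncomputable section

/-- A ReLU network configuration with input dimension `d`:
a finite sequence of matrix–vector pairs `(A_i, b_i)`, `i = 0, …, depth − 1`. -/
structure ReLUNet (d : ℕ) where
  depth : ℕ
  depth_pos : 0 < depth
  width : ℕ → ℕ
  width_in : width 0 = d
  width_out : width depth = 1
  A : ∀ i : ℕ, Matrix (Fin (width (i + 1))) (Fin (width i)) ℝ
  b : ∀ i : ℕ, Fin (width (i + 1)) → ℝ

namespace ReLUNet

variable {d : ℕ}

/-- The affine map `x ↦ A_i x + b_i` of layer `i`. -/
def layer (Φ : ReLUNet d) (i : ℕ) (x : Fin (Φ.width i) → ℝ) :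
    Fin (Φ.width (i + 1)) → ℝ :=
  fun j => (∑ k, Φ.A i j k * x k) + Φ.b i j

/-- Output after the first `i` affine layers, with the ReLU activation `ρ(x) = max{x,0}`
applied between consecutive affine layers (not on the input and not after the last
affine layer). -/
def forward (Φ : ReLUNet d) : (i : ℕ) → (Fin (Φ.width 0) → ℝ) → Fin (Φ.width i) → ℝ
  | 0, x => x
  | i + 1, x =>
      Φ.layer i fun k => if i = 0 then Φ.forward i x k else max (Φ.forward i x k) 0

/-- The realization `R(Φ) : ℝ^d → ℝ` of a network configuration. -/
def realization (Φ : ReLUNet d) (x : Fin d → ℝ) : ℝ :=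
  Φ.forward Φ.depth (fun k => x (Fin.cast Φ.width_in k)) (Fin.cast Φ.width_out.symm 0)

/-- All layer widths are at most `W`. -/
def widthLe (Φ : ReLUNet d) (W : ℕ) : Prop :=
  ∀ i ≤ Φ.depth, Φ.width i ≤ W

/-- All weights have absolute value at most `B`. -/
def magLe (Φ : ReLUNet d) (B : ℝ) : Prop :=
  ∀ i < Φ.depth, (∀ j k, |Φ.A i j k| ≤ B) ∧ ∀ j, |Φ.b i j| ≤ B

/-- All weights take values in the set `𝔸`. -/
def coefIn (Φ : ReLUNet d) (𝔸 : Set ℝ) : Prop :=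
  ∀ i < Φ.depth, (∀ j k, Φ.A i j k ∈ 𝔸) ∧ ∀ j, Φ.b i j ∈ 𝔸

open Classical in
/-- The connectivity (total number of nonzero weights) of a network configuration. -/
def connectivity (Φ : ReLUNet d) : ℕ :=
  ∑ i ∈ Finset.range Φ.depth,
    ((Finset.univ.filter fun jk : Fin (Φ.width (i + 1)) × Fin (Φ.width i) =>
        Φ.A i jk.1 jk.2 ≠ 0).card
      + (Finset.univ.filter fun j : Fin (Φ.width (i + 1)) => Φ.b i j ≠ 0).card)

end ReLUNet

/-- `R(d,W,L,B)`: realizations of ReLU networks with input dimension `d`, output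
dimension 1, width at most `W`, depth at most `L`, and weight magnitude at most `B`. -/
def RclassB (d W L : ℕ) (B : ℝ) : Set ((Fin d → ℝ) → ℝ) :=
  {f | ∃ Φ : ReLUNet d, Φ.widthLe W ∧ Φ.depth ≤ L ∧ Φ.magLe B ∧ Φ.realization = f}

/-- `R(d,W,L)`: realizations with width at most `W` and depth at most `L`,
with no constraint on the weight magnitude. -/
def Rclass (d W L : ℕ) : Set ((Fin d → ℝ) → ℝ) :=
  {f | ∃ Φ : ReLUNet d, Φ.widthLe W ∧ Φ.depth ≤ L ∧ Φ.realization = f}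

/-- `R_𝔸(d,W,L)`: realizations with width at most `W`, depth at most `L`, and all
weights taking values in `𝔸`. -/
def RclassCoef (d W L : ℕ) (𝔸 : Set ℝ) : Set ((Fin d → ℝ) → ℝ) :=
  {f | ∃ Φ : ReLUNet d, Φ.widthLe W ∧ Φ.depth ≤ L ∧ Φ.coefIn 𝔸 ∧ Φ.realization = f}

/-- `R(d,W,L,B,s)`: realizations with width ≤ `W`, depth ≤ `L`, weight magnitude ≤ `B`,
and connectivity ≤ `s`. -/
def RclassSparse (d W L : ℕ) (B : ℝ) (s : ℕ) : Set ((Fin d → ℝ) → ℝ) :=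
  {f | ∃ Φ : ReLUNet d, Φ.widthLe W ∧ Φ.depth ≤ L ∧ Φ.magLe B ∧
    Φ.connectivity ≤ s ∧ Φ.realization = f}

/-- The unit cube `[0,1]^d`. -/
def unitCube (d : ℕ) : Set (Fin d → ℝ) := Set.univ.pi fun _ => Set.Icc (0 : ℝ) 1

/-- The `L^p([0,1]^d)` distance between two functions on `ℝ^d` (with `p = ⊤`
corresponding to `L^∞`). -/
def cubeDist (d : ℕ) (p : ℝ≥0∞) (f g : (Fin d → ℝ) → ℝ) : ℝ≥0∞ :=
  eLpNorm (f - g) p (volume.restrict (unitCube d))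

/-- The `L^p([0,1])` distance between two functions on `ℝ`. -/
def intervalDist (p : ℝ≥0∞) (f g : ℝ → ℝ) : ℝ≥0∞ :=
  eLpNorm (f - g) p (volume.restrict (Set.Icc (0 : ℝ) 1))

/-- The `ε`-covering number of `X` with respect to the extended distance `δ`:
the cardinality of a smallest subset `C ⊆ X` such that every point of `X` is within
distance `ε` of some point of `C` (equal to `⊤` if no finite covering exists). -/
def coveringNumber {α : Type*} (ε : ℝ≥0∞) (X : Set α) (δ : α → α → ℝ≥0∞) : ℕ∞ :=
  sInf {n : ℕ∞ | ∃ C : Finset α, ↑C ⊆ X ∧ (∀ x ∈ X, ∃ c ∈ C, δ x c ≤ ε) ∧ (C.card : ℕ∞) = n}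

/-- The `ε`-packing number of `X` with respect to the extended distance `δ`:
the cardinality of a largest subset of `X` whose points have pairwise distances `> ε`. -/
def packingNumber {α : Type*} (ε : ℝ≥0∞) (X : Set α) (δ : α → α → ℝ≥0∞) : ℕ∞ :=
  sSup {n : ℕ∞ | ∃ C : Finset α, ↑C ⊆ X ∧
    (∀ x ∈ C, ∀ y ∈ C, x ≠ y → ε < δ x y) ∧ (C.card : ℕ∞) = n}

/-- Base-2 logarithm of an extended natural number, valued in `ℝ≥0∞`. -/
def elog2 (n : ℕ∞) : ℝ≥0∞ :=
  if n = ⊤ then ⊤ else ENNReal.ofReal (Real.logb 2 (n.toNat : ℝ))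

/-- The minimax approximation error `A(G, F, δ) = sup_{g ∈ G} inf_{f ∈ F} δ(f, g)`. -/
def minimaxErr {α : Type*} (G F : Set α) (δ : α → α → ℝ≥0∞) : ℝ≥0∞ :=
  ⨆ g ∈ G, ⨅ f ∈ F, δ f g

/-- The forward pass of a ReLU network whose weights are indexed by natural numbers. -/
def rawForward (w : ℕ → ℕ) (a : ℕ → ℕ → ℕ → ℝ) (β : ℕ → ℕ → ℝ) (x : ℕ → ℝ) : ℕ → ℕ → ℝ
  | 0, j => x j
  | i + 1, j =>
      (∑ k ∈ Finset.range (w i),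
        a i j k * (if i = 0 then rawForward w a β x i k else max (rawForward w a β x i k) 0))
        + β i j

/-- Extension of a finite vector by zero. -/
def zeroExtend {d : ℕ} (x : Fin d → ℝ) (k : ℕ) : ℝ := if h : k < d then x ⟨k, h⟩ else 0

theorem zeroExtend_coe {d : ℕ} (x : Fin d → ℝ) (k : Fin d) : zeroExtend x k = x k := by
  simp [zeroExtend]

theorem rawForward_congr {w : ℕ → ℕ} {a a' : ℕ → ℕ → ℕ → ℝ} {β β' : ℕ → ℕ → ℝ} (x : ℕ → ℝ)
    (n : ℕ) (ha : ∀ i < n, a i = a' i) (hβ : ∀ i < n, β i = β' i) :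
    rawForward w a β x n = rawForward w a' β' x n := by
  induction n with
  | zero => funext j; rfl
  | succ n ih =>
    funext j
    simp only [rawForward, ha n n.lt_succ_self, hβ n n.lt_succ_self,
      ih (fun i hi => ha i (by omega)) (fun i hi => hβ i (by omega))]

theorem ReLUNet.forward_eq_rawForward {d : ℕ} (Φ : ReLUNet d) {w : ℕ → ℕ}
    {a : ℕ → ℕ → ℕ → ℝ} {β : ℕ → ℕ → ℝ} {x : Fin (Φ.width 0) → ℝ} {y : ℕ → ℝ}
    (hx : ∀ k, x k = y k) (n : ℕ) (hw : ∀ i < n, Φ.width i = w i)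
    (ha : ∀ i < n, ∀ j k, Φ.A i j k = a i j k) (hβ : ∀ i < n, ∀ j, Φ.b i j = β i j)
    (j : Fin (Φ.width n)) : Φ.forward n x j = rawForward w a β y n j := by
  induction n with
  | zero => exact hx j
  | succ n ih =>
    have ih' := ih (fun i hi => hw i (by omega)) (fun i hi => ha i (by omega))
      (fun i hi => hβ i (by omega))
    simp only [ReLUNet.forward, ReLUNet.layer, rawForward, ha n n.lt_succ_self,
      hβ n n.lt_succ_self, ih', ← hw n n.lt_succ_self]
    rw [Fin.sum_univ_eq_sum_range (fun k => a n j k *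
      (if n = 0 then rawForward w a β y n k else max (rawForward w a β y n k) 0))]

theorem ReLUNet.realization_eq_rawForward {d : ℕ} (Φ : ReLUNet d) {w : ℕ → ℕ}
    {a : ℕ → ℕ → ℕ → ℝ} {β : ℕ → ℕ → ℝ} (hw : ∀ i < Φ.depth, Φ.width i = w i)
    (ha : ∀ i < Φ.depth, ∀ j k, Φ.A i j k = a i j k)
    (hβ : ∀ i < Φ.depth, ∀ j, Φ.b i j = β i j) (x : Fin d → ℝ) :
    Φ.realization x = rawForward w a β (zeroExtend x) Φ.depth 0 := by
  rw [ReLUNet.realization,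
    Φ.forward_eq_rawForward (y := zeroExtend x) (fun k => ?_) Φ.depth hw ha hβ]
  · simp
  · exact (zeroExtend_coe x (Fin.cast Φ.width_in k)).symm

theorem ReLUNet.continuous_forward {d : ℕ} (Φ : ReLUNet d) (n : ℕ) :
    Continuous (Φ.forward n) := by
  induction n with
  | zero => exact continuous_id
  | succ n ih =>
    have h (k) : Continuous fun x => Φ.forward n x k := (continuous_apply k).comp ih
    refine continuous_pi fun j => ?_
    simp only [ReLUNet.forward, ReLUNet.layer]
    refine (continuous_finsetSum _ fun k _ => continuous_const.mul ?_).add continuous_const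
    split_ifs
    · exact h k
    · exact (h k).max continuous_const

theorem ReLUNet.continuous_realization {d : ℕ} (Φ : ReLUNet d) : Continuous Φ.realization :=
  (continuous_apply _).comp
    ((Φ.continuous_forward Φ.depth).comp (continuous_pi fun _ => continuous_apply _))

/-- Finite data describing all networks of width at most `W`, depth at most `L` and weights
in `𝔸`: the depth, the widths, the matrix entries and the bias entries. -/
abbrev NetData (W L : ℕ) (𝔸 : Set ℝ) : Type :=
  Fin (L + 1) × (Fin L → Fin (W + 1)) × (Fin L → Fin W → Fin W → 𝔸) × (Fin L → Fin W → 𝔸)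

/-- The function realized by the network described by finite data. -/
def NetData.realization {W L : ℕ} {𝔸 : Set ℝ} (D : NetData W L 𝔸) {d : ℕ} (x : Fin d → ℝ) : ℝ :=
  rawForward (fun i => if h : i < L then D.2.1 ⟨i, h⟩ else 0)
    (fun i j k => if h : i < L ∧ j < W ∧ k < W then
      D.2.2.1 ⟨i, h.1⟩ ⟨j, h.2.1⟩ ⟨k, h.2.2⟩ else 0)
    (fun i j => if h : i < L ∧ j < W then D.2.2.2 ⟨i, h.1⟩ ⟨j, h.2⟩ else 0)
    (zeroExtend x) D.1 0

theorem exists_netData {d W L : ℕ} {𝔸 : Set ℝ} (h𝔸 : 𝔸.Nonempty) {f : (Fin d → ℝ) → ℝ}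
    (hf : f ∈ RclassCoef d W L 𝔸) : ∃ D : NetData W L 𝔸, D.realization = f := by
  classical
  obtain ⟨Φ, hW, hL, hc, rfl⟩ := hf
  obtain ⟨z, hz⟩ := h𝔸
  refine ⟨⟨⟨Φ.depth, by omega⟩,
    fun i => if h : (i : ℕ) ≤ Φ.depth then ⟨Φ.width i, Nat.lt_succ_of_le (hW i h)⟩ else 0,
    fun i j k => if h : ((i : ℕ) < Φ.depth ∧ (j : ℕ) < Φ.width (i + 1)) ∧ (k : ℕ) < Φ.width i then
      ⟨Φ.A i ⟨j, h.1.2⟩ ⟨k, h.2⟩, (hc i h.1.1).1 _ _⟩ else ⟨z, hz⟩,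
    fun i j => if h : (i : ℕ) < Φ.depth ∧ (j : ℕ) < Φ.width (i + 1) then
      ⟨Φ.b i ⟨j, h.2⟩, (hc i h.1).2 _⟩ else ⟨z, hz⟩⟩, ?_⟩
  funext x
  rw [NetData.realization]
  refine (Φ.realization_eq_rawForward ?_ ?_ ?_ x).symm
  · intro i hi
    simp [hi.le, hi.trans_le hL]
  · intro i hi j k
    have hj := j.2.trans_le (hW _ hi)
    have hk := k.2.trans_le (hW _ hi.le)
    simp [hi, hi.trans_le hL, hj, hk]
  · intro i hi j
    have hj := j.2.trans_le (hW _ hi)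
    simp [hi, hi.trans_le hL, hj]

theorem card_netData {W L : ℕ} {𝔸 : Set ℝ} [Fintype 𝔸] :
    Fintype.card (NetData W L 𝔸) =
      (L + 1) * ((W + 1) ^ L * (((Fintype.card 𝔸 ^ W) ^ W) ^ L * (Fintype.card 𝔸 ^ W) ^ L)) := by
  simp only [NetData, Fintype.card_prod, Fintype.card_pi, Finset.prod_const, Finset.card_univ,
    Fintype.card_fin]

theorem card_netData_le {W L : ℕ} {𝔸 : Set ℝ} [Fintype 𝔸] (hW : 1 ≤ W)
    (h𝔸 : 2 ≤ Fintype.card 𝔸) :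
    Fintype.card (NetData W L 𝔸) ≤ Fintype.card 𝔸 ^ (4 * (W ^ 2 * L)) := by
  rw [card_netData]
  set n := Fintype.card 𝔸
  have hpow (m : ℕ) : m + 1 ≤ n ^ m :=
    (Nat.lt_two_pow_self (n := m)).trans_le (Nat.pow_le_pow_left h𝔸 m)
  have hWW : W ≤ W ^ 2 := Nat.le_self_pow two_ne_zero W
  calc _ ≤ n ^ L * ((n ^ W) ^ L * (((n ^ W) ^ W) ^ L * (n ^ W) ^ L)) := by
        gcongr <;> apply hpow
    _ = n ^ (L + W * L + W ^ 2 * L + W * L) := by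
        simp only [← pow_mul, ← pow_add]; congr 1; ring
    _ ≤ n ^ (4 * (W ^ 2 * L)) := by
        refine Nat.pow_le_pow_right (by omega) ?_
        have : W * L ≤ W ^ 2 * L := by gcongr
        have : 1 * L ≤ W * L := by gcongr
        omega

/-- `v` is the family of activations after `n ≥ 1` layers of some network of width at most `W` and
weight magnitude at most `B`. -/
def IsHidden (d W : ℕ) (B : ℝ) (n : ℕ) {ι : Type} (v : (Fin d → ℝ) → ι → ℝ) : Prop :=
  ∃ (a : ℕ → ℕ → ℕ → ℝ) (β : ℕ → ℕ → ℝ) (e : ι → ℕ),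
    (∀ i j k, |a i j k| ≤ B) ∧ (∀ i j, |β i j| ≤ B) ∧ Function.Injective e ∧ (∀ i, e i < W) ∧
    ∀ x i, max (rawForward (fun i => if i = 0 then d else W) a β (zeroExtend x) n (e i)) 0 = v x i

theorem exists_injective_lt {ι : Type} [Fintype ι] {W : ℕ} (h : Fintype.card ι ≤ W) :
    ∃ e : ι → ℕ, Function.Injective e ∧ ∀ i, e i < W :=
  ⟨fun i => Fintype.equivFin ι i,
    fun _ _ hij => (Fintype.equivFin ι).injective (Fin.ext hij),
    fun i => (Fintype.equivFin ι i).2.trans_le h⟩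

theorem abs_extend_le {α β : Type} {f : α → β} (hf : Function.Injective f) {g : α → ℝ} {B : ℝ}
    (hB : 0 ≤ B) (hg : ∀ i, |g i| ≤ B) (b : β) : |Function.extend f g 0 b| ≤ B := by
  by_cases h : ∃ i, f i = b
  · obtain ⟨i, rfl⟩ := h
    rw [hf.extend_apply]; exact hg i
  · rw [Function.extend_apply' _ _ _ h]; simpa using hB

theorem sum_range_extend_mul {ι : Type} [Fintype ι] {e : ι → ℕ} (he : Function.Injective e) {W : ℕ}
    (hW : ∀ i, e i < W) (g : ι → ℝ) (f : ℕ → ℝ) :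
    ∑ k ∈ Finset.range W, Function.extend e g 0 k * f k = ∑ i, g i * f (e i) := by
  symm
  refine Finset.sum_of_injOn e he.injOn (fun i _ => by simpa using hW i) ?_ ?_
  · intro k _ hk
    rw [Function.extend_apply' _ _ _ (by simpa using hk)]; simp
  · intro i _
    rw [he.extend_apply]

theorem isHidden_one {d W : ℕ} {B : ℝ} (hB : 0 ≤ B) {κ : Type} [Fintype κ]
    (hκ : Fintype.card κ ≤ W) {v : (Fin d → ℝ) → κ → ℝ}
    (hv : ∀ j, ∃ (c : Fin d → ℝ) (b : ℝ), (∀ i, |c i| ≤ B) ∧ |b| ≤ B ∧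
      ∀ x, v x j = max ((∑ i, c i * x i) + b) 0) :
    IsHidden d W B 1 v := by
  choose c b hc hb hcb using hv
  obtain ⟨e, he, heW⟩ := exists_injective_lt hκ
  have hval : Function.Injective (fun i : Fin d => (i : ℕ)) := Fin.val_injective
  refine ⟨fun _ => Function.extend e (fun j => Function.extend Fin.val (c j) 0) 0,
    fun _ => Function.extend e b 0, e, ?_, ?_, he, heW, ?_⟩
  · intro i j k
    by_cases h : ∃ i, e i = j
    · obtain ⟨j, rfl⟩ := h
      simp only [he.extend_apply]; exact abs_extend_le hval hB (hc j) k
    · simp only [Function.extend_apply' _ _ _ h]; simpa using hB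
  · exact fun _ => abs_extend_le he hB hb
  · intro x j
    simp only [rawForward, if_true, he.extend_apply]
    rw [sum_range_extend_mul hval (fun i => i.2), hcb]
    simp [zeroExtend_coe]

theorem IsHidden.succ {d W n : ℕ} {B : ℝ} (hB : 0 ≤ B) {ι κ : Type} [Fintype ι] [Fintype κ]
    {u : (Fin d → ℝ) → ι → ℝ} (hu : IsHidden d W B n u) (hn : n ≠ 0)
    (hκ : Fintype.card κ ≤ W) {v : (Fin d → ℝ) → κ → ℝ}
    (hv : ∀ j, ∃ (c : ι → ℝ) (b : ℝ), (∀ i, |c i| ≤ B) ∧ |b| ≤ B ∧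
      ∀ x, v x j = max ((∑ i, c i * u x i) + b) 0) :
    IsHidden d W B (n + 1) v := by
  choose c b hc hb hcb using hv
  obtain ⟨a, β, e, ha, hβ, he, heW, hu⟩ := hu
  obtain ⟨e', he', heW'⟩ := exists_injective_lt hκ
  refine ⟨Function.update a n (Function.extend e' (fun j => Function.extend e (c j) 0) 0),
    Function.update β n (Function.extend e' b 0), e', ?_, ?_, he', heW', ?_⟩
  · intro i j k
    by_cases hi : i = n
    · subst hi
      rw [Function.update_self]
      by_cases h : ∃ i, e' i = j
      · obtain ⟨j, rfl⟩ := h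
        rw [he'.extend_apply]; exact abs_extend_le he hB (hc j) k
      · rw [Function.extend_apply' _ _ _ h]; simpa using hB
    · rw [Function.update_of_ne hi]; exact ha i j k
  · intro i j
    by_cases hi : i = n
    · subst hi
      rw [Function.update_self]; exact abs_extend_le he' hB hb j
    · rw [Function.update_of_ne hi]; exact hβ i j
  · intro x j
    simp only [rawForward, hn, if_false, Function.update_self, he'.extend_apply]
    rw [sum_range_extend_mul he heW, hcb,
      rawForward_congr (a' := a) (β' := β) _ n (fun i hi => Function.update_of_ne hi.ne _ _)
        (fun i hi => Function.update_of_ne hi.ne _ _)]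
    simp only [hu]

theorem IsHidden.mem_RclassB {d W n L : ℕ} {B : ℝ} (hB : 0 ≤ B) {ι : Type} [Fintype ι]
    {u : (Fin d → ℝ) → ι → ℝ} (hu : IsHidden d W B n u) (hn : n ≠ 0) (hd : d ≤ W) (hW : 1 ≤ W)
    (hL : n + 1 ≤ L) {c : ι → ℝ} {b : ℝ} (hc : ∀ i, |c i| ≤ B) (hb : |b| ≤ B) :
    (fun x => (∑ i, c i * u x i) + b) ∈ RclassB d W L B := by
  obtain ⟨a, β, e, ha, hβ, he, heW, hu⟩ := hu
  set a' := Function.update a n (fun _ => Function.extend e c 0) with ha'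
  set β' := Function.update β n (fun _ => b) with hβ'
  refine ⟨{
    depth := n + 1
    depth_pos := n.succ_pos
    width := fun i => if i = n + 1 then 1 else if i = 0 then d else W
    width_in := by simp
    width_out := by simp
    A := fun i j k => a' i j k
    b := fun i j => β' i j }, ?_, hL, ?_, ?_⟩
  · intro i _
    dsimp only
    split_ifs <;> omega
  · intro i _
    refine ⟨fun j k => ?_, fun j => ?_⟩
    · by_cases hi : i = n
      · subst hi
        simp only [ha', Function.update_self]; exact abs_extend_le he hB hc _
      · simp only [ha', Function.update_of_ne hi]; exact ha _ _ _
    · by_cases hi : i = n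
      · subst hi
        simpa only [hβ', Function.update_self] using hb
      · simp only [hβ', Function.update_of_ne hi]; exact hβ _ _
  · funext x
    rw [ReLUNet.realization_eq_rawForward (w := fun i => if i = 0 then d else W) (a := a')
      (β := β') _ ?_ (fun _ _ _ _ => rfl) (fun _ _ _ => rfl)]
    · simp only [rawForward, hn, if_false, ha', hβ', Function.update_self]
      rw [sum_range_extend_mul he heW,
        rawForward_congr (a' := a) (β' := β) _ n (fun i hi => Function.update_of_ne hi.ne _ _)
          (fun i hi => Function.update_of_ne hi.ne _ _)]
      simp only [hu]
    · intro i hi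
      dsimp only at hi ⊢
      rw [if_neg hi.ne]

/-- The tent of height `r / 4` over the interval `[0, r]`. -/
def tent (r y : ℝ) : ℝ := max (y / 2 - max (y - r / 2) 0) 0

theorem tent_nonneg (r y : ℝ) : 0 ≤ tent r y := le_max_right _ _

theorem tent_of_nonpos {r y : ℝ} (hr : 0 ≤ r) (hy : y ≤ 0) : tent r y = 0 := by
  rw [tent, max_eq_right (a := y - r / 2) (by linarith), max_eq_right (by linarith)]

theorem tent_of_le_half {r y : ℝ} (h0 : 0 ≤ y) (hy : y ≤ r / 2) : tent r y = y / 2 := by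
  rw [tent, max_eq_right (a := y - r / 2) (by linarith), max_eq_left (by linarith), sub_zero]

theorem tent_of_le {r y : ℝ} (hy : r ≤ y) : tent r y = 0 := by
  rw [tent, max_eq_right]
  linarith [le_max_left (y - r / 2) 0]

theorem tent_le_half {r y : ℝ} (hy : 0 ≤ y) : tent r y ≤ y / 2 :=
  max_le (by linarith [le_max_right (y - r / 2) 0]) (by linarith)

theorem le_tent {r y : ℝ} (h1 : r / 4 ≤ y) (h2 : y ≤ 3 * r / 4) : r / 8 ≤ tent r y := by
  refine le_trans ?_ (le_max_left _ _)
  rcases max_cases (y - r / 2) 0 with ⟨h, _⟩ | ⟨h, _⟩ <;> rw [h] <;> linarith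

/-- A piecewise linear function which, on the `i`-th interval of length `s`, is a tent minus a
combination with coefficients `T i j` of narrow tents. -/
def selector {w : ℕ} (s r : ℝ) (a b : Fin w → ℝ) (T : Fin w → Fin w → ℝ) (y : ℝ) : ℝ :=
  ∑ i, max (tent s (y - a i) - ∑ j, T i j * tent r ((∑ m, tent s (y - a m)) - b j)) 0

theorem selector_nonneg {w : ℕ} (s r : ℝ) (a b : Fin w → ℝ) (T : Fin w → Fin w → ℝ) (y : ℝ) :
    0 ≤ selector s r a b T y :=
  Finset.sum_nonneg fun _ _ => le_max_right _ _

theorem selector_eq_zero {w : ℕ} {s r : ℝ} {a b : Fin w → ℝ} {T : Fin w → Fin w → ℝ} {y : ℝ}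
    (hT : ∀ i j, 0 ≤ T i j) (h : ∀ i, tent s (y - a i) = 0) : selector s r a b T y = 0 := by
  refine Finset.sum_eq_zero fun i _ => max_eq_right ?_
  rw [h i, zero_sub, neg_nonpos]
  exact Finset.sum_nonneg fun j _ => mul_nonneg (hT i j) (tent_nonneg _ _)

theorem selector_eq {w : ℕ} {s r : ℝ} {a b : Fin w → ℝ} {T : Fin w → Fin w → ℝ} {y : ℝ}
    (hT : ∀ i j, 0 ≤ T i j) (hT1 : ∀ i j, T i j ≤ 1) (i j : Fin w)
    (hi : ∀ m, m ≠ i → tent s (y - a m) = 0)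
    (hj : ∀ m, m ≠ j → tent r (tent s (y - a i) - b m) = 0) (hb : 0 ≤ b j)
    (hbj : b j ≤ tent s (y - a i)) :
    selector s r a b T y = tent s (y - a i) - T i j * tent r (tent s (y - a i) - b j) := by
  have hsum : ∑ m, tent s (y - a m) = tent s (y - a i) :=
    Finset.sum_eq_single i (fun m _ hm => hi m hm) (by simp)
  rw [selector, Finset.sum_eq_single i]
  · rw [hsum, Finset.sum_eq_single j (fun m _ hm => by rw [hj m hm, mul_zero]) (by simp),
      max_eq_left]
    have h1 := tent_le_half (r := r) (sub_nonneg.2 hbj)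
    have h2 := tent_nonneg r (tent s (y - a i) - b j)
    nlinarith [hT1 i j]
  · intro m _ hm
    refine max_eq_right ?_
    rw [hi m hm, zero_sub, neg_nonpos]
    exact Finset.sum_nonneg fun j _ => mul_nonneg (hT m j) (tent_nonneg _ _)
  · simp

theorem exists_copy {d : ℕ} {B : ℝ} (hB : 1 ≤ B) {ι : Type} [Fintype ι] (u : (Fin d → ℝ) → ι → ℝ)
    (i₀ : ι) (h : ∀ x, 0 ≤ u x i₀) :
    ∃ (c : ι → ℝ) (b : ℝ), (∀ i, |c i| ≤ B) ∧ |b| ≤ B ∧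
      ∀ x, u x i₀ = max ((∑ i, c i * u x i) + b) 0 := by
  classical
  have hB0 : 0 ≤ B := by linarith
  refine ⟨fun i => if i = i₀ then 1 else 0, 0, fun i => ?_, by simpa, fun x => by simp [h]⟩
  dsimp only
  split_ifs <;> simpa

theorem IsHidden.add_selector {d W w n : ℕ} {B : ℝ} (hB : 1 ≤ B) (hw : 2 * w + 2 ≤ W)
    {X acc : (Fin d → ℝ) → ℝ} (hX : ∀ x, 0 ≤ X x) (hacc : ∀ x, 0 ≤ acc x) {s r : ℝ}
    {a b : Fin w → ℝ} {T : Fin w → Fin w → ℝ} (hs : 0 ≤ s) (hr : 0 ≤ r) (ha : ∀ i, 0 ≤ a i)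
    (ha1 : ∀ i, a i + s / 2 ≤ 1) (hb : ∀ i, 0 ≤ b i) (hb1 : ∀ i, b i + r / 2 ≤ 1)
    (hT : ∀ i j, 0 ≤ T i j) (hT1 : ∀ i j, T i j ≤ 1) (hn : n ≠ 0)
    (h : IsHidden d W B n (fun x => ![X x, acc x])) :
    IsHidden d W B (n + 6) (fun x => ![X x, acc x + selector s r a b T (X x)]) := by
  have hB0 : 0 ≤ B := by linarith
  have h0 : |(0 : ℝ)| ≤ B := by simpa
  have h1 : |(1 : ℝ)| ≤ B := by simpa
  have hm1 : |(-1 : ℝ)| ≤ B := by simpa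
  have h12 : |(1 / 2 : ℝ)| ≤ B := by rw [abs_of_nonneg] <;> linarith
  have hbd {y : ℝ} (hy : -1 ≤ y) (hy' : y ≤ 1) : |y| ≤ B := (abs_le.2 ⟨hy, hy'⟩).trans hB
  have hite {P : Prop} [Decidable P] {y z : ℝ} (hy : |y| ≤ B) (hz : |z| ≤ B) :
      |if P then y else z| ≤ B := by split_ifs <;> assumption
  let p : (Fin d → ℝ) → Fin w → ℝ := fun x m => max (X x - a m - s / 2) 0
  let t : (Fin d → ℝ) → Fin w → ℝ := fun x m => tent s (X x - a m)
  let u : (Fin d → ℝ) → ℝ := fun x => ∑ m, t x m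
  let q : (Fin d → ℝ) → Fin w → ℝ := fun x j => max (u x - b j - r / 2) 0
  let g : (Fin d → ℝ) → Fin w → ℝ := fun x i => max (t x i - ∑ j, T i j * tent r (u x - b j)) 0
  let v₀ : (Fin d → ℝ) → Fin 2 → ℝ := fun x => ![X x, acc x]
  let v₁ : (Fin d → ℝ) → Fin w ⊕ Fin 2 → ℝ := fun x => Sum.elim (p x) ![X x, acc x]
  let v₂ : (Fin d → ℝ) → Fin w ⊕ Fin 2 → ℝ := fun x => Sum.elim (t x) ![X x, acc x]
  let v₃ : (Fin d → ℝ) → (Fin w ⊕ Fin w) ⊕ Fin 2 → ℝ :=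
    fun x => Sum.elim (Sum.elim (q x) (t x)) ![X x, acc x]
  let v₄ : (Fin d → ℝ) → (Fin w ⊕ Fin w) ⊕ Fin 2 → ℝ :=
    fun x => Sum.elim (Sum.elim (fun j => tent r (u x - b j)) (t x)) ![X x, acc x]
  let v₅ : (Fin d → ℝ) → Fin w ⊕ Fin 2 → ℝ := fun x => Sum.elim (g x) ![X x, acc x]
  have ht (x m) : 0 ≤ t x m := tent_nonneg _ _
  have hL1 : IsHidden d W B (n + 1) v₁ := by
    refine h.succ hB0 hn (by simp; omega) ?_
    rintro (m | j)
    · refine ⟨![1, 0], -(a m + s / 2), by simp [Fin.forall_fin_two, hB, hB0], ?_, fun x => ?_⟩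
      · exact hbd (by linarith [ha1 m]) (by linarith [ha m])
      · simp only [v₁, Sum.elim_inl, Fin.sum_univ_two, p]; congr 1; simp; ring
    · fin_cases j
      · exact exists_copy hB v₀ 0 hX
      · exact exists_copy hB v₀ 1 hacc
  have hL2 : IsHidden d W B (n + 2) v₂ := by
    refine hL1.succ hB0 (by omega) (by simp; omega) ?_
    rintro (m | j)
    · refine ⟨Sum.elim (fun i => if i = m then -1 else 0) ![1 / 2, 0], -(a m / 2), ?_, ?_,
        fun x => ?_⟩
      · rintro (i | i)
        · exact hite hm1 h0
        · fin_cases i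
          · exact h12
          · exact h0
      · exact hbd (by linarith [ha1 m]) (by linarith [ha m])
      · simp only [v₁, v₂, Sum.elim_inl, Sum.elim_inr, Fintype.sum_sum_type, Fin.sum_univ_two, t,
          tent, p]
        congr 1
        simp
        ring
    · fin_cases j
      · exact exists_copy hB v₁ (.inr 0) hX
      · exact exists_copy hB v₁ (.inr 1) hacc
  have hL3 : IsHidden d W B (n + 3) v₃ := by
    refine hL2.succ hB0 (by omega) (by simp; omega) ?_
    rintro ((m | m) | j)
    · refine ⟨Sum.elim 1 0, -(b m + r / 2), ?_, ?_, fun x => ?_⟩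
      · simp [hB, hB0]
      · exact hbd (by linarith [hb1 m]) (by linarith [hb m])
      · simp only [v₂, v₃, Sum.elim_inl, Sum.elim_inr, Fintype.sum_sum_type, q, u]
        congr 1
        simp
        ring
    · exact exists_copy hB v₂ (.inl m) (ht · m)
    · fin_cases j
      · exact exists_copy hB v₂ (.inr 0) hX
      · exact exists_copy hB v₂ (.inr 1) hacc
  have hL4 : IsHidden d W B (n + 4) v₄ := by
    refine hL3.succ hB0 (by omega) (by simp; omega) ?_
    rintro ((m | m) | j)
    · refine ⟨Sum.elim (Sum.elim (fun i => if i = m then -1 else 0) (fun _ => 1 / 2)) 0,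
        -(b m / 2), ?_, ?_, fun x => ?_⟩
      · rintro ((i | i) | i)
        · exact hite hm1 h0
        · exact h12
        · exact h0
      · exact hbd (by linarith [hb1 m]) (by linarith [hb m])
      · simp only [v₃, v₄, Sum.elim_inl, Sum.elim_inr, Fintype.sum_sum_type, q, tent]
        congr 1
        simp [← Finset.mul_sum]
        simp only [u]
        ring
    · exact exists_copy hB v₃ (.inl (.inr m)) (ht · m)
    · fin_cases j
      · exact exists_copy hB v₃ (.inr 0) hX
      · exact exists_copy hB v₃ (.inr 1) hacc
  have hL5 : IsHidden d W B (n + 5) v₅ := by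
    refine hL4.succ hB0 (by omega) (by simp; omega) ?_
    rintro (m | j)
    · refine ⟨Sum.elim (Sum.elim (fun j => -T m j) (fun i => if i = m then 1 else 0)) 0, 0, ?_, h0,
        fun x => ?_⟩
      · rintro ((i | i) | i)
        · exact hbd (neg_le_neg (hT1 m i)) (show -T m i ≤ 1 by linarith [hT m i])
        · exact hite h1 h0
        · exact h0
      · simp only [v₄, v₅, Sum.elim_inl, Sum.elim_inr, Fintype.sum_sum_type, g]
        congr 1
        simp
        ring
    · fin_cases j
      · exact exists_copy hB v₄ (.inr 0) hX
      · exact exists_copy hB v₄ (.inr 1) hacc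
  refine hL5.succ hB0 (by omega) (by simp; omega) ?_
  intro j
  fin_cases j
  · exact exists_copy hB v₅ (.inr 0) hX
  · refine ⟨Sum.elim 1 ![0, 1], 0, ?_, h0, fun x => ?_⟩
    · simp [Fin.forall_fin_two, hB, hB0]
    · have := add_nonneg (hacc x) (selector_nonneg s r a b T (X x))
      simp only [v₅, Sum.elim_inl, Sum.elim_inr, Fintype.sum_sum_type, Fin.sum_univ_two]
      simp [g, u, t]
      rw [← selector, add_comm (selector _ _ _ _ _ _), max_eq_left this]

theorem isHidden_sum_selector {d W w : ℕ} {B : ℝ} (hB : 1 ≤ B) (hd : 0 < d) (hw : 2 * w + 2 ≤ W)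
    {s r : ℝ} {a : ℕ → Fin w → ℝ} {b : Fin w → ℝ} {T : ℕ → Fin w → Fin w → ℝ} (hs : 0 ≤ s)
    (hr : 0 ≤ r) (ha : ∀ k i, 0 ≤ a k i) (hb : ∀ i, 0 ≤ b i) (hb1 : ∀ i, b i + r / 2 ≤ 1)
    (hT : ∀ k i j, 0 ≤ T k i j) (hT1 : ∀ k i j, T k i j ≤ 1) (K : ℕ)
    (ha1 : ∀ k < K, ∀ i, a k i + s / 2 ≤ 1) :
    IsHidden d W B (6 * K + 1) (fun x => ![max (x ⟨0, hd⟩) 0,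
      ∑ k ∈ Finset.range K, selector s r (a k) b (T k) (max (x ⟨0, hd⟩) 0)]) := by
  have hB0 : 0 ≤ B := by linarith
  induction K with
  | zero =>
    refine isHidden_one hB0 (by simp; omega) fun j => ?_
    fin_cases j
    · refine ⟨fun i => if i = ⟨0, hd⟩ then 1 else 0, 0, fun i => ?_, by simpa, fun x => by simp⟩
      dsimp only
      split_ifs <;> simpa
    · exact ⟨0, 0, by simp [hB0], by simpa, fun x => by simp⟩
  | succ K ih =>
    have := (ih fun k hk => ha1 k (by omega)).add_selector hB hw (fun x => le_max_right _ _)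
      (fun x => Finset.sum_nonneg fun k _ => selector_nonneg _ _ _ _ _ _) hs hr (ha K)
      (ha1 K K.lt_succ_self) hb hb1 (hT K) (hT1 K) (by omega)
    simp only [Finset.sum_range_succ]
    exact this

theorem IsHidden.amplify {d W n : ℕ} {B : ℝ} (hB : 0 ≤ B) (hn : n ≠ 0)
    {y : (Fin d → ℝ) → ℝ} (hy : ∀ x, 0 ≤ y x) (h : IsHidden d W B n (fun x (_ : Fin W) => y x))
    (N : ℕ) : IsHidden d W B (n + N) (fun x (_ : Fin W) => (W * B) ^ N * y x) := by
  induction N with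
  | zero => simpa using h
  | succ N ih =>
    refine ih.succ hB (by omega) (by simp) fun j =>
      ⟨fun _ => B, 0, fun _ => (abs_of_nonneg hB).le, by simpa, fun x => ?_⟩
    have := mul_nonneg (pow_nonneg (mul_nonneg W.cast_nonneg hB) (N + 1)) (hy x)
    simp only [Finset.sum_const, Finset.card_univ, Fintype.card_fin, nsmul_eq_mul, add_zero]
    rw [max_eq_left] <;> ring_nf at this ⊢
    exact this

theorem sum_selector_mem_RclassB {d W w L : ℕ} {B : ℝ} (hB : 1 ≤ B) (hd : 0 < d) (hdW : d ≤ W)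
    (hw : 2 * w + 2 ≤ W) {s r : ℝ} {a : ℕ → Fin w → ℝ} {b : Fin w → ℝ}
    {T : ℕ → Fin w → Fin w → ℝ} (hs : 0 ≤ s) (hr : 0 ≤ r) (ha : ∀ k i, 0 ≤ a k i)
    (hb : ∀ i, 0 ≤ b i) (hb1 : ∀ i, b i + r / 2 ≤ 1) (hT : ∀ k i j, 0 ≤ T k i j)
    (hT1 : ∀ k i j, T k i j ≤ 1) (K N : ℕ) (ha1 : ∀ k < K, ∀ i, a k i + s / 2 ≤ 1)
    (hL : 6 * K + N + 3 ≤ L) :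
    (fun x => (W * B) ^ N *
      ∑ k ∈ Finset.range K, selector s r (a k) b (T k) (max (x ⟨0, hd⟩) 0)) ∈ RclassB d W L B := by
  have hB0 : 0 ≤ B := by linarith
  have hnn (x : Fin d → ℝ) :
      0 ≤ ∑ k ∈ Finset.range K, selector s r (a k) b (T k) (max (x ⟨0, hd⟩) 0) :=
    Finset.sum_nonneg fun k _ => selector_nonneg _ _ _ _ _ _
  have h1 := isHidden_sum_selector hB hd hw hs hr ha hb hb1 hT hT1 K ha1
  have h2 : IsHidden d W B (6 * K + 1 + 1) (fun x (_ : Fin W) =>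
      ∑ k ∈ Finset.range K, selector s r (a k) b (T k) (max (x ⟨0, hd⟩) 0)) := by
    refine h1.succ hB0 (by omega) (by simp) fun j =>
      ⟨![0, 1], 0, ?_, by simpa, fun x => by simp [hnn]⟩
    simp [Fin.forall_fin_two, hB, hB0]
  have h3 := h2.amplify hB0 (by omega) hnn N
  have h4 := h3.mem_RclassB hB0 (by omega) hdW (by omega) (L := L) (by omega)
    (c := fun i => if i = ⟨0, by omega⟩ then 1 else 0) (b := 0)
    (fun i => by split_ifs <;> simpa) (by simpa)
  simpa using h4

theorem sum_selector_eq {w ℓ : ℕ} {T : ℕ → Fin w → Fin w → ℝ} (hT : ∀ k i j, 0 ≤ T k i j)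
    (hT1 : ∀ k i j, T k i j ≤ 1) {s r : ℝ} (hr : 0 ≤ r) (hs : s = 4 * w * r) {k : ℕ} (hk : k < ℓ)
    (i j : Fin w) {y : ℝ} (hy1 : (k * w + i) * s + 2 * j * r + r / 2 ≤ y)
    (hy2 : y ≤ (k * w + i) * s + 2 * j * r + 3 * r / 2) :
    ∑ k ∈ Finset.range ℓ, selector s r (fun i => (k * w + i) * s) (fun j => j * r) (T k) y =
      (y - (k * w + i) * s) / 2 - T k i j * tent r ((y - (k * w + i) * s) / 2 - j * r) := by
  have hs0 : 0 ≤ s := hs ▸ by positivity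
  have hjw : ((j : ℕ) : ℝ) + 1 ≤ w := by exact_mod_cast j.2
  have hj0 : 0 ≤ (j : ℝ) * r := by positivity
  have hjr : ((j : ℕ) : ℝ) * r + r ≤ w * r := by nlinarith
  have htent : tent s (y - (k * w + i) * s) = (y - (k * w + i) * s) / 2 :=
    tent_of_le_half (by linarith) (by nlinarith)
  have hother (k' : ℕ) (i' : Fin w) (h : k' * w + i' ≠ k * w + i) :
      tent s (y - (k' * w + i') * s) = 0 := by
    rcases h.lt_or_gt with h | h
    · have h' : (k' * w + i' + 1 : ℝ) ≤ k * w + i := by exact_mod_cast h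
      refine tent_of_le ?_
      nlinarith [mul_le_mul_of_nonneg_right h' hs0]
    · have h' : (k * w + i + 1 : ℝ) ≤ k' * w + i' := by exact_mod_cast h
      refine tent_of_nonpos hs0 ?_
      nlinarith [mul_le_mul_of_nonneg_right h' hs0]
  rw [Finset.sum_eq_single k]
  · rw [selector_eq (hT k) (hT1 k) i j, htent]
    · intro m hm
      refine hother k m fun h => hm (Fin.ext ?_)
      omega
    · intro m hm
      rw [htent]
      rcases (Fin.val_ne_of_ne hm).lt_or_gt with h | h
      · have h' : (m + 1 : ℝ) ≤ j := by exact_mod_cast h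
        refine tent_of_le ?_
        nlinarith
      · have h' : (j + 1 : ℝ) ≤ m := by exact_mod_cast h
        refine tent_of_nonpos hr ?_
        nlinarith
    · positivity
    · rw [htent]
      linarith
  · intro k' _ hk'
    refine selector_eq_zero (hT k') fun i' => hother k' i' fun h => hk' ?_
    have := congrArg (· / w) h
    have hw : 0 < w := i.pos
    simpa [Nat.mul_comm _ w, Nat.mul_add_div hw, Nat.div_eq_of_lt] using this
  · simp [hk]

instance (d : ℕ) : IsProbabilityMeasure (volume.restrict (unitCube d)) :=
  ⟨by rw [Measure.restrict_apply_univ, unitCube, volume_pi_pi]; simp⟩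

theorem volume_slab {d : ℕ} (i₀ : Fin d) {α β : ℝ} (h0 : 0 ≤ α) (h1 : β ≤ 1) :
    volume.restrict (unitCube d) {x | x i₀ ∈ Set.Icc α β} = ENNReal.ofReal (β - α) := by
  classical
  have hm : MeasurableSet {x : Fin d → ℝ | x i₀ ∈ Set.Icc α β} :=
    measurable_pi_apply i₀ measurableSet_Icc
  rw [Measure.restrict_apply hm]
  have : {x : Fin d → ℝ | x i₀ ∈ Set.Icc α β} ∩ unitCube d =
      Set.univ.pi (Function.update (fun _ => Set.Icc (0 : ℝ) 1) i₀ (Set.Icc α β)) := by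
    ext x
    simp only [unitCube, Set.mem_inter_iff, Set.mem_ofPred_eq, Set.mem_univ_pi]
    constructor
    · rintro ⟨h, h'⟩ i
      rcases eq_or_ne i i₀ with rfl | hi
      · simpa using h
      · simpa [hi] using h' i
    · intro h
      have hi₀ : x i₀ ∈ Set.Icc α β := by simpa using h i₀
      refine ⟨hi₀, fun i => ?_⟩
      rcases eq_or_ne i i₀ with rfl | hi
      · exact ⟨h0.trans hi₀.1, hi₀.2.trans h1⟩
      · simpa [hi] using h i
  rw [this, volume_pi_pi, Finset.prod_eq_single i₀]
  · simp
  · intro i _ hi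
    simp [hi]
  · simp

theorem le_cubeDist_one {d : ℕ} (i₀ : Fin d) {f g : (Fin d → ℝ) → ℝ} {α β η : ℝ} (h0 : 0 ≤ α)
    (h1 : β ≤ 1) (hη : 0 ≤ η) (h : ∀ x, x i₀ ∈ Set.Icc α β → η ≤ |f x - g x|) :
    ENNReal.ofReal (η * (β - α)) ≤ cubeDist d 1 f g := by
  rw [cubeDist, eLpNorm_one_eq_lintegral_enorm, ENNReal.ofReal_mul hη, ← volume_slab i₀ h0 h1,
    ← setLIntegral_const]
  refine le_trans ?_ (setLIntegral_le_lintegral {x | x i₀ ∈ Set.Icc α β} _)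
  refine setLIntegral_mono' ((measurable_pi_apply i₀) measurableSet_Icc) fun x hx => ?_
  rw [Pi.sub_apply, Real.enorm_eq_ofReal_abs]
  exact ENNReal.ofReal_le_ofReal (h x hx)

theorem cubeDist_one_le {d : ℕ} {p : ℝ≥0∞} (hp : 1 ≤ p) {f g : (Fin d → ℝ) → ℝ}
    (hf : Continuous f) (hg : Continuous g) : cubeDist d 1 f g ≤ cubeDist d p f g :=
  eLpNorm_le_eLpNorm_of_exponent_le hp (hf.sub hg).aestronglyMeasurable

theorem cubeDist_one_triangle {d : ℕ} {f g g' : (Fin d → ℝ) → ℝ}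
    (hf : Continuous f) (hg : Continuous g) (hg' : Continuous g') :
    cubeDist d 1 g g' ≤ cubeDist d 1 f g' + cubeDist d 1 f g := by
  have := eLpNorm_sub_le (μ := volume.restrict (unitCube d)) (p := 1)
    (hf.sub hg').aestronglyMeasurable (hf.sub hg).aestronglyMeasurable le_rfl
  rwa [show f - g' - (f - g) = g - g' by abel] at this

/-- The function obtained by prescribing one value out of `Q` in each of the `ℓ * w ^ 2` cells of
`[0, 1]`. -/
def packingFun {d : ℕ} (hd : 0 < d) (W : ℕ) (B : ℝ) (N : ℕ) {w ℓ Q : ℕ}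
    (T : Fin ℓ → Fin w → Fin w → Fin Q) (x : Fin d → ℝ) : ℝ :=
  (W * B) ^ N * ∑ k ∈ Finset.range ℓ,
    selector (1 / (w * ℓ)) (1 / (4 * w ^ 2 * ℓ)) (fun i => (k * w + i) * (1 / (w * ℓ)))
      (fun j => j * (1 / (4 * w ^ 2 * ℓ)))
      (fun i j => if h : k < ℓ then (T ⟨k, h⟩ i j : ℝ) / Q else 0) (max (x ⟨0, hd⟩) 0)

theorem cell_le_one {w ℓ k : ℕ} (hk : k < ℓ) (i : Fin w) :
    ((k * w + i : ℝ) + 1) * (1 / (w * ℓ)) ≤ 1 := by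
  have hw : 0 < w := i.pos
  have h : k * w + i + 1 ≤ w * ℓ := by nlinarith [i.2, Nat.mul_le_mul_left w hk]
  have h' : (k * w + i + 1 : ℝ) ≤ w * ℓ := by exact_mod_cast h
  rw [mul_one_div]
  exact div_le_one_of_le₀ h' (by positivity)

theorem coe_div_mem_Icc {Q : ℕ} (t : Fin Q) : (t : ℝ) / Q ∈ Set.Icc (0 : ℝ) 1 :=
  ⟨by positivity, div_le_one_of_le₀ (by exact_mod_cast t.2.le) (by positivity)⟩

theorem dite_div_mem_Icc {w ℓ Q : ℕ} (T : Fin ℓ → Fin w → Fin w → Fin Q) (k : ℕ) (i j : Fin w) :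
    (if h : k < ℓ then (T ⟨k, h⟩ i j : ℝ) / Q else 0) ∈ Set.Icc (0 : ℝ) 1 := by
  split_ifs
  · exact coe_div_mem_Icc _
  · simp

theorem packingFun_mem_RclassB {d W L : ℕ} {B : ℝ} (hB : 1 ≤ B) (hd : 0 < d) (hdW : d ≤ W)
    {w ℓ N Q : ℕ} (hw : 2 * w + 2 ≤ W) (hℓ : 0 < ℓ) (hL : 6 * ℓ + N + 3 ≤ L)
    (T : Fin ℓ → Fin w → Fin w → Fin Q) : packingFun hd W B N T ∈ RclassB d W L B := by
  refine sum_selector_mem_RclassB hB hd hdW hw (by positivity) (by positivity)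
    (fun k i => by positivity) (fun j => by positivity) (fun j => ?_)
    (fun k i j => (dite_div_mem_Icc T k i j).1) (fun k i j => (dite_div_mem_Icc T k i j).2) ℓ N
    (fun k hk i => ?_) hL
  · have hw0 : 0 < w := j.pos
    have h1 : (j + 1 / 2 : ℝ) ≤ w := by
      have : (j + 1 : ℝ) ≤ w := by exact_mod_cast j.2
      linarith
    have hw1 : (1 : ℝ) ≤ w := by exact_mod_cast hw0
    have hℓ1 : (1 : ℝ) ≤ ℓ := by exact_mod_cast hℓ
    have h2 : (w : ℝ) ≤ 4 * w ^ 2 * ℓ := by nlinarith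
    calc (j * (1 / (4 * w ^ 2 * ℓ)) + 1 / (4 * w ^ 2 * ℓ) / 2 : ℝ)
        = (j + 1 / 2) / (4 * w ^ 2 * ℓ) := by ring
      _ ≤ 1 := div_le_one_of_le₀ (h1.trans h2) (by positivity)
  · have hs : (0 : ℝ) ≤ 1 / (w * ℓ) := by positivity
    linarith [cell_le_one hk i]

theorem le_cubeDist_packingFun {d W : ℕ} {B : ℝ} (hB : 0 ≤ B) (hd : 0 < d) {w ℓ N Q : ℕ}
    {T T' : Fin ℓ → Fin w → Fin w → Fin Q} (hT : T ≠ T') :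
    ENNReal.ofReal ((W * B) ^ N * (1 / (4 * w ^ 2 * ℓ)) ^ 2 / (8 * Q)) ≤
      cubeDist d 1 (packingFun hd W B N T) (packingFun hd W B N T') := by
  obtain ⟨k, i, j, hkij⟩ : ∃ k i j, T k i j ≠ T' k i j := by
    by_contra! h
    exact hT (funext fun k => funext fun i => funext fun j => h k i j)
  have hw : 0 < w := i.pos
  have hℓ : 0 < ℓ := k.pos
  have hQ : 0 < Q := (T k i j).pos
  set s : ℝ := 1 / (w * ℓ) with hs
  set r : ℝ := 1 / (4 * w ^ 2 * ℓ) with hr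
  have hr0 : 0 < r := by positivity
  have hsr : s = 4 * w * r := by rw [hs, hr]; field_simp
  set α : ℝ := ((k : ℕ) * w + i) * s + 2 * j * r + r / 2 with hα
  have hcell := cell_le_one k.2 i
  rw [← hs] at hcell
  have hβ : α + r ≤ 1 := by
    have hj : (j + 1 : ℝ) ≤ w := by exact_mod_cast j.2
    nlinarith [mul_le_mul_of_nonneg_right hj hr0.le]
  have hα0 : 0 ≤ α := by positivity
  have hη : 0 ≤ (W * B) ^ N * (r / (8 * Q)) := by positivity
  refine le_trans (ENNReal.ofReal_le_ofReal (le_of_eq ?_))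
    (le_cubeDist_one ⟨0, hd⟩ hα0 hβ hη fun x hx => ?_)
  · ring
  · have hx0 : max (x ⟨0, hd⟩) 0 = x ⟨0, hd⟩ := max_eq_left (hα0.trans hx.1)
    have hx1 := hx.1
    have hx2 : x ⟨0, hd⟩ ≤ (k * w + i) * s + 2 * j * r + 3 * r / 2 := by linarith [hx.2]
    have heval (S : Fin ℓ → Fin w → Fin w → Fin Q) := sum_selector_eq
      (fun k i j => (dite_div_mem_Icc S k i j).1) (fun k i j => (dite_div_mem_Icc S k i j).2)
      hr0.le hsr k.2 i j hx1 hx2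
    set τ := tent r ((x ⟨0, hd⟩ - (k * w + i) * s) / 2 - j * r)
    have hτr : r / 8 ≤ τ := le_tent (by linarith) (by linarith)
    rw [packingFun, packingFun, ← hs, ← hr, hx0, heval T, heval T', ← mul_sub, abs_mul,
      abs_of_nonneg (by positivity)]
    refine mul_le_mul_of_nonneg_left ?_ (by positivity)
    simp only [Fin.is_lt, dite_true, Fin.eta]
    have hdiff : (1 : ℝ) ≤ |(T' k i j : ℝ) - T k i j| := by
      have : ((T' k i j : ℕ) : ℤ) - (T k i j : ℕ) ≠ 0 := by
        intro h
        exact hkij (Fin.ext (by omega))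
      exact_mod_cast Int.one_le_abs this
    calc r / (8 * Q) = 1 * (r / 8) / Q := by field_simp
      _ ≤ |(T' k i j : ℝ) - T k i j| * τ / Q := by gcongr
      _ = |((T' k i j : ℝ) - T k i j) * τ / Q| := by
        rw [abs_div, abs_mul, abs_of_nonneg (show 0 ≤ τ from tent_nonneg _ _), Nat.abs_cast]
      _ = _ := by congr 1; ring

theorem rpow_le_amplification {W L : ℕ} {B : ℝ} (hW : 60 ≤ W) (hB : 1 ≤ B) :
    (((W : ℝ) + 1) ^ L * B ^ L) ^ (1 / 16 : ℝ) ≤ (W * B) ^ (L / 8 + 1) := by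
  have hW' : (60 : ℝ) ≤ W := by exact_mod_cast hW
  have hY : 1 ≤ W * B := by nlinarith
  have h1 : ((W : ℝ) + 1) * B ≤ (W * B) ^ 2 := by
    rw [mul_pow]
    exact mul_le_mul (by nlinarith) (by nlinarith) (by linarith) (by positivity)
  have h2 : ((W : ℝ) + 1) ^ L * B ^ L ≤ ((W * B) ^ (L / 8 + 1)) ^ 16 := by
    rw [← mul_pow, ← pow_mul]
    calc (((W : ℝ) + 1) * B) ^ L ≤ ((W * B) ^ 2) ^ L := by gcongr
      _ = (W * B) ^ (2 * L) := by rw [← pow_mul]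
      _ ≤ (W * B) ^ ((L / 8 + 1) * 16) := pow_le_pow_right₀ hY (by omega)
  calc (((W : ℝ) + 1) ^ L * B ^ L) ^ (1 / 16 : ℝ)
      ≤ (((W * B) ^ (L / 8 + 1)) ^ 16) ^ (1 / 16 : ℝ) := by gcongr
    _ = (W * B) ^ (L / 8 + 1) := by
      rw [← Real.rpow_natCast_mul (by positivity)]
      norm_num

theorem nat_le_two_pow_div_eight {L : ℕ} (hL : 56 ≤ L) : L ≤ 9 * 2 ^ (L / 8) := by
  have : L / 8 < 2 ^ (L / 8) := Nat.lt_two_pow_self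
  omega

theorem amplification_dominates {W L w ℓ : ℕ} {B : ℝ} (hW : 60 ≤ W) (hL : 60 ≤ L) (hB : 1 ≤ B)
    (hw0 : 0 < w) (hℓ0 : 0 < ℓ) (hw : 4 * w ≤ W) (hℓ : ℓ ≤ L) :
    2 * (W * B) ^ (L / 8 + 1) ≤ (W * B) ^ (L / 2) * (1 / (4 * w ^ 2 * ℓ)) ^ 2 / 8 := by
  have hW' : (60 : ℝ) ≤ W := by exact_mod_cast hW
  set Y : ℝ := W * B
  set m := L / 8
  have hY60 : 60 ≤ Y := by nlinarith
  have hWY : (W : ℝ) ≤ Y := by nlinarith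
  have hL1 : (L : ℝ) ^ 2 ≤ Y ^ (m + 2) := by
    have h : (L : ℝ) ≤ 9 * 2 ^ m := by exact_mod_cast nat_le_two_pow_div_eight (by omega)
    calc (L : ℝ) ^ 2 ≤ (9 * 2 ^ m) ^ 2 := by gcongr
      _ = 4 ^ m * 81 := by rw [mul_pow, ← pow_mul, mul_comm m, pow_mul]; norm_num; ring
      _ ≤ Y ^ m * Y ^ 2 := by gcongr <;> nlinarith
      _ = Y ^ (m + 2) := by ring
  have hden : (4 * w ^ 2 * ℓ : ℝ) ≤ W ^ 2 * L := by
    have hw' : (4 * w : ℝ) ≤ W := by exact_mod_cast hw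
    have hℓ' : (ℓ : ℝ) ≤ L := by exact_mod_cast hℓ
    gcongr
    nlinarith [sq_nonneg (w : ℝ)]
  have hkey : 2 * Y ^ (m + 1) * 8 * (4 * w ^ 2 * ℓ) ^ 2 ≤ Y ^ (L / 2) :=
    calc 2 * Y ^ (m + 1) * 8 * (4 * w ^ 2 * ℓ) ^ 2
        ≤ 2 * Y ^ (m + 1) * 8 * (W ^ 2 * L) ^ 2 := by gcongr
      _ = 16 * Y ^ (m + 1) * W ^ 4 * (L : ℝ) ^ 2 := by ring
      _ ≤ Y * Y ^ (m + 1) * Y ^ 4 * Y ^ (m + 2) := by gcongr; linarith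
      _ = Y ^ (2 * m + 8) := by ring
      _ ≤ Y ^ (L / 2) := pow_le_pow_right₀ (by linarith) (by omega)
  rw [div_pow, one_pow, mul_one_div, div_div, le_div_iff₀ (by positivity)]
  linarith

theorem min_le_rpow {x : ℝ} (hx : 0 ≤ x) : min (1 / 8) x ≤ x ^ (1 / 16 : ℝ) := by
  rcases le_total x 1 with h | h
  · exact (min_le_right _ _).trans (Real.self_le_rpow_of_le_one hx h (by norm_num))
  · exact (min_le_left _ _).trans
      ((by norm_num : (1 / 8 : ℝ) ≤ 1).trans (Real.one_le_rpow h (by norm_num)))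

theorem rpow_two_neg_logb {n : ℕ} (hn : 0 < n) (C : ℕ) :
    ((2 : ℝ) ^ (-(16 * C * Real.logb 2 n))) ^ (1 / 16 : ℝ) = 1 / (n ^ C : ℕ) := by
  rw [← Real.rpow_mul (by norm_num),
    show -(16 * C * Real.logb 2 n) * (1 / 16) = Real.logb 2 n * (-C : ℝ) by ring,
    Real.rpow_mul (by norm_num), Real.rpow_logb (by norm_num) (by norm_num) (by exact_mod_cast hn),
    Real.rpow_neg (by positivity), Real.rpow_natCast, one_div, Nat.cast_pow]

theorem continuous_of_mem_RclassB {d W L : ℕ} {B : ℝ} {f : (Fin d → ℝ) → ℝ}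
    (hf : f ∈ RclassB d W L B) : Continuous f := by
  obtain ⟨Φ, -, -, -, rfl⟩ := hf
  exact Φ.continuous_realization

theorem continuous_of_mem_RclassCoef {d W L : ℕ} {𝔸 : Set ℝ} {f : (Fin d → ℝ) → ℝ}
    (hf : f ∈ RclassCoef d W L 𝔸) : Continuous f := by
  obtain ⟨Φ, -, -, -, rfl⟩ := hf
  exact Φ.continuous_realization

/-- A family in `RclassB` which is `2 ε`-separated in `L¹` and has more members than there are
networks with weights in `𝔸` cannot be approximated to within `ε`. -/
theorem le_minimaxErr_of_separated {d W L : ℕ} {B : ℝ} {𝔸 : Set ℝ} [Fintype 𝔸] {p : ℝ≥0∞}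
    (h𝔸 : 𝔸.Nonempty) (hp : 1 ≤ p) {ι : Type} [Fintype ι] {g : ι → (Fin d → ℝ) → ℝ} {ε : ℝ≥0∞}
    (hg : ∀ i, g i ∈ RclassB d W L B)
    (hcard : Fintype.card (NetData W L 𝔸) < Fintype.card ι)
    (hsep : ∀ i j, i ≠ j → ε + ε ≤ cubeDist d 1 (g i) (g j)) :
    ε ≤ minimaxErr (RclassB d W L B) (RclassCoef d W L 𝔸) (cubeDist d p) := by
  by_contra! h
  have hD (i : ι) : ∃ D : NetData W L 𝔸, Continuous (D.realization (d := d)) ∧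
      cubeDist d p D.realization (g i) < ε := by
    have hi : ⨅ f ∈ RclassCoef d W L 𝔸, cubeDist d p f (g i) < ε :=
      (le_iSup₂ (f := fun g _ => ⨅ f ∈ RclassCoef d W L 𝔸, cubeDist d p f g) (g i) (hg i)).trans_lt
        h
    simp only [iInf_lt_iff] at hi
    obtain ⟨f, hf, hlt⟩ := hi
    obtain ⟨D, rfl⟩ := exists_netData h𝔸 hf
    exact ⟨D, continuous_of_mem_RclassCoef hf, hlt⟩
  choose D hDc hDlt using hD
  obtain ⟨i, j, hij, hDij⟩ := Fintype.exists_ne_map_eq_of_card_lt D hcard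
  have hci := continuous_of_mem_RclassB (hg i)
  have hcj := continuous_of_mem_RclassB (hg j)
  have h1 := (cubeDist_one_le hp (hDc i) hci).trans_lt (hDlt i)
  have h2 := (cubeDist_one_le hp (hDc j) hcj).trans_lt (hDlt j)
  rw [← hDij] at h2
  exact absurd ((hsep i j hij).trans (cubeDist_one_triangle (hDc i) hci hcj))
    (not_le.2 (ENNReal.add_lt_add h2 h1))

/-- Lower bound on the worst-case weight-quantization error: for any
finite weight set `𝔸` with `|𝔸| ≥ 2`,
`A(R(d,W,L,B), R_𝔸(d,W,L), ‖·‖_{L^p([0,1]^d)}) ≥ min{1/8, (W+1)^L B^L 2^{−c log|𝔸|}}`. -/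
theorem quantization_error_lower_bound :
    ∃ c : ℝ, 0 < c ∧
      ∀ (p : ℝ≥0∞) (d W L : ℕ) (B : ℝ) (𝔸 : Set ℝ),
        1 ≤ p → 0 < d → d ≤ W → 60 ≤ W → 60 ≤ L → 1 ≤ B →
        𝔸.Finite → 2 ≤ 𝔸.ncard →
        ENNReal.ofReal
            (min (1 / 8)
              (((W : ℝ) + 1) ^ L * B ^ L *
                (2 : ℝ) ^ (-(c * Real.logb 2 (𝔸.ncard : ℝ)))))
          ≤ minimaxErr (RclassB d W L B) (RclassCoef d W L 𝔸) (cubeDist d p) := by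
  refine ⟨16 * (3601 : ℕ), by norm_num, fun p d W L B 𝔸 hp hd hdW hW hL hB hfin hcard => ?_⟩
  have := hfin.fintype
  rw [Set.ncard_eq_toFinset_card', Set.toFinset_card] at hcard ⊢
  set n := Fintype.card 𝔸
  set Q := n ^ 3601 with hQ
  have hQ0 : 0 < Q := by positivity
  set ε : ℝ := min (1 / 8) (((W : ℝ) + 1) ^ L * B ^ L *
    (2 : ℝ) ^ (-(16 * (3601 : ℕ) * Real.logb 2 (n : ℝ))))
  have hε0 : 0 ≤ ε := by positivity
  have hεle : ε ≤ (W * B) ^ (L / 8 + 1) * (1 / (Q : ℕ)) := by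
    refine (min_le_rpow (by positivity)).trans ?_
    rw [Real.mul_rpow (by positivity) (by positivity), rpow_two_neg_logb (by omega) 3601]
    exact mul_le_mul_of_nonneg_right (rpow_le_amplification hW hB) (by positivity)
  refine le_minimaxErr_of_separated (ι := Fin (L / 24) → Fin (W / 4) → Fin (W / 4) → Fin Q)
    (Set.nonempty_of_ncard_ne_zero ?_) hp
    (fun T => packingFun_mem_RclassB hB hd hdW (by omega) (by omega) (by omega) T) ?_
    fun T T' hT => le_trans ?_ (le_cubeDist_packingFun (N := L / 2) (by linarith) hd hT)
  · rw [Set.ncard_eq_toFinset_card', Set.toFinset_card]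
    omega
  · refine (card_netData_le (by omega) hcard).trans_lt ?_
    simp only [Fintype.card_pi, Finset.prod_const, Finset.card_univ, Fintype.card_fin]
    rw [hQ, ← pow_mul, ← pow_mul, ← pow_mul]
    refine Nat.pow_lt_pow_right hcard ?_
    have h1 : W ≤ 5 * (W / 4) := by omega
    have h2 : L ≤ 36 * (L / 24) := by omega
    have h3 : 0 < W / 4 := by omega
    have h4 : 0 < L / 24 := by omega
    calc 4 * (W ^ 2 * L) ≤ 4 * ((5 * (W / 4)) ^ 2 * (36 * (L / 24))) := by gcongr
      _ = 3600 * ((W / 4) ^ 2 * (L / 24)) := by ring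
      _ < 3601 * ((W / 4) ^ 2 * (L / 24)) := by gcongr; norm_num
      _ = _ := by ring
  · rw [← ENNReal.ofReal_add hε0 hε0]
    refine ENNReal.ofReal_le_ofReal ?_
    have h := amplification_dominates (w := W / 4) (ℓ := L / 24) hW hL hB (by omega) (by omega)
      (by omega) (by omega)
    calc ε + ε ≤ 2 * (W * B) ^ (L / 8 + 1) * (1 / Q) := by linarith
      _ ≤ (W * B) ^ (L / 2) * (1 / (4 * (W / 4 : ℕ) ^ 2 * (L / 24 : ℕ))) ^ 2 / 8 * (1 / Q) := by
        gcongr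
      _ = _ := by rw [mul_one_div, div_div]
end
end

section
/- There exist absolute constants C, D ∈ ℝ_+ such that for all W, L ∈ ℕ with W, L ≥ D and every p ∈ [1,∞], the minimax error in approximating the class of 1-Lipschitz functions bounded by 1 through ReLU networks with weights bounded by 1 satisfies A(H^1([0,1]), R(1,W,L,1), ‖·‖_{L^p([0,1])}) ≤ C · (W² L² log(W))^{−1}. -/
open MeasureTheory ProbabilityTheory ENNReal

noncomputable section

/-- `H¹([0,1])`: continuous functions on `[0,1]` bounded by 1 and 1-Lipschitz. -/
def H1 : Set (ℝ → ℝ) :=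
  {f | ContinuousOn f (Set.Icc 0 1) ∧ (∀ x ∈ Set.Icc (0 : ℝ) 1, |f x| ≤ 1) ∧
    ∀ x ∈ Set.Icc (0 : ℝ) 1, ∀ y ∈ Set.Icc (0 : ℝ) 1, |f x - f y| ≤ |x - y|}

/-- View a function on `ℝ^1` as a function of one real variable. -/
def toOneVar (g : (Fin 1 → ℝ) → ℝ) : ℝ → ℝ := fun t => g fun _ => t

/-- `R(1,W,L,B)` viewed as a set of functions of one real variable. -/
def RclassB₁ (W L : ℕ) (B : ℝ) : Set (ℝ → ℝ) := toOneVar '' RclassB 1 W L B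

/-- `R(1,W,L)` (no weight-magnitude constraint) viewed as a set of functions of
one real variable. -/
def Rclass₁ (W L : ℕ) : Set (ℝ → ℝ) := toOneVar '' Rclass 1 W L

namespace ReLUApprox

open Finset

variable {X : Type}

/-- `g` is an affine combination of the functions `F i` whose coefficients and constant term are
bounded by `B`. -/
def AffineIn {ι : Type} [Fintype ι] (B : ℝ) (F : ι → X → ℝ) (g : X → ℝ) : Prop :=
  ∃ (a : ι → ℝ) (b : ℝ), (∀ i, |a i| ≤ B) ∧ |b| ≤ B ∧ ∀ x, g x = ∑ i, a i * F i x + b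

namespace AffineIn

variable {ι κ : Type} [Fintype ι] [Fintype κ] {B B' : ℝ} {F : ι → X → ℝ} {g g' : X → ℝ}

theorem congr (h : AffineIn B F g) (hB : B ≤ B') (hg : ∀ x, g' x = g x) : AffineIn B' F g' := by
  obtain ⟨a, b, ha, hb, h⟩ := h
  exact ⟨a, b, fun i => (ha i).trans hB, hb.trans hB, fun x => (hg x).trans (h x)⟩

theorem mono (h : AffineIn B F g) (hB : B ≤ B') : AffineIn B' F g := h.congr hB fun _ => rfl

theorem coord (F : ι → X → ℝ) (i : ι) : AffineIn 1 F (F i) := by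
  classical
  refine ⟨Pi.single i 1, 0, fun j => ?_, by simp, fun x => ?_⟩
  · by_cases h : j = i
    · subst h; simp
    · simp [h]
  · simp [Pi.single_apply]

theorem const (F : ι → X → ℝ) (c : ℝ) : AffineIn |c| F fun _ => c :=
  ⟨0, c, fun i => by simp, le_rfl, fun x => by simp⟩

theorem add (h : AffineIn B F g) (h' : AffineIn B' F g') :
    AffineIn (B + B') F fun x => g x + g' x := by
  obtain ⟨a, b, ha, hb, h⟩ := h
  obtain ⟨a', b', ha', hb', h'⟩ := h'
  refine ⟨a + a', b + b', fun i => (abs_add_le _ _).trans (add_le_add (ha i) (ha' i)),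
    (abs_add_le _ _).trans (add_le_add hb hb'), fun x => ?_⟩
  simp only [h, h', Pi.add_apply, add_mul, sum_add_distrib]
  ring

theorem smul (h : AffineIn B F g) (c : ℝ) : AffineIn (|c| * B) F fun x => c * g x := by
  obtain ⟨a, b, ha, hb, h⟩ := h
  refine ⟨fun i => c * a i, c * b, fun i => ?_, ?_, fun x => ?_⟩
  · rw [abs_mul]; exact mul_le_mul_of_nonneg_left (ha i) (abs_nonneg c)
  · rw [abs_mul]; exact mul_le_mul_of_nonneg_left hb (abs_nonneg c)
  · simp only [h, mul_add, mul_sum, mul_assoc]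

theorem neg (h : AffineIn B F g) : AffineIn B F fun x => -g x :=
  (h.smul (-1)).congr (by simp) fun x => by ring

theorem sub (h : AffineIn B F g) (h' : AffineIn B' F g') :
    AffineIn (B + B') F fun x => g x - g' x :=
  (h.add h'.neg).congr le_rfl fun x => by ring

theorem sum {C : κ → ℝ} {f : κ → X → ℝ} (h : ∀ k, AffineIn (C k) F (f k)) :
    AffineIn (∑ k, C k) F fun x => ∑ k, f k x := by
  choose a b ha hb h using h
  refine ⟨fun i => ∑ k, a k i, ∑ k, b k, fun i => ?_, ?_, fun x => ?_⟩
  · exact (abs_sum_le_sum_abs _ _).trans (sum_le_sum fun k _ => ha k i)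
  · exact (abs_sum_le_sum_abs _ _).trans (sum_le_sum fun k _ => hb k)
  · simp only [h, sum_add_distrib, sum_mul]
    rw [sum_comm]

/-- A sum of `card κ` functions with a common coefficient bound. -/
theorem sum_const {C : ℝ} {f : κ → X → ℝ} (h : ∀ k, AffineIn C F (f k)) :
    AffineIn (Fintype.card κ * C) F fun x => ∑ k, f k x :=
  (sum h).mono (by simp)

theorem inl (h : AffineIn B F g) (hB : 0 ≤ B) (F' : κ → X → ℝ) :
    AffineIn B (Sum.elim F F') g := by
  obtain ⟨a, b, ha, hb, h⟩ := h
  refine ⟨Sum.elim a 0, b, ?_, hb, fun x => by simp [h]⟩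
  rintro (i | i)
  · exact ha i
  · simpa using hB

theorem inr (h : AffineIn B F g) (hB : 0 ≤ B) (F' : κ → X → ℝ) :
    AffineIn B (Sum.elim F' F) g := by
  obtain ⟨a, b, ha, hb, h⟩ := h
  refine ⟨Sum.elim 0 a, b, ?_, hb, fun x => by simp [h]⟩
  rintro (i | i)
  · simpa using hB
  · exact ha i

end AffineIn

/-- `h` is the positive part of an affine combination of the `F i` with coefficients bounded
by `B`, that is, a neuron in a layer following the neurons `F i`. -/
def Neuron {ι : Type} [Fintype ι] (B : ℝ) (F : ι → X → ℝ) (h : X → ℝ) : Prop :=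
  ∃ g, AffineIn B F g ∧ ∀ x, h x = max (g x) 0

namespace Neuron

variable {ι κ : Type} [Fintype ι] [Fintype κ] {B B' : ℝ} {F : ι → X → ℝ} {g h : X → ℝ}

theorem relu (hg : AffineIn B F g) : Neuron B F fun x => max (g x) 0 := ⟨g, hg, fun _ => rfl⟩

theorem of_nonneg (hg : AffineIn B F g) (h0 : ∀ x, 0 ≤ g x) : Neuron B F g :=
  ⟨g, hg, fun x => (max_eq_left (h0 x)).symm⟩

theorem coord (hB : 1 ≤ B) (i : ι) (h0 : ∀ x, 0 ≤ F i x) : Neuron B F (F i) :=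
  of_nonneg ((AffineIn.coord F i).mono hB) h0

theorem mono (hg : Neuron B F h) (hB : B ≤ B') : Neuron B' F h :=
  let ⟨g, h1, h2⟩ := hg; ⟨g, h1.mono hB, h2⟩

theorem inl (hg : Neuron B F h) (hB : 0 ≤ B) (F' : κ → X → ℝ) : Neuron B (Sum.elim F F') h :=
  let ⟨g, h1, h2⟩ := hg; ⟨g, h1.inl hB F', h2⟩

theorem inr (hg : Neuron B F h) (hB : 0 ≤ B) (F' : κ → X → ℝ) : Neuron B (Sum.elim F' F) h :=
  let ⟨g, h1, h2⟩ := hg; ⟨g, h1.inr hB F', h2⟩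

end Neuron

/-- `Computes w B G ℓ ι F`: the family `G` is obtained from the family `F` by `ℓ` successive layers
of at most `w` neurons each, with weights bounded by `B`. -/
inductive Computes (w : ℕ) (B : ℝ) {κ : Type} [Fintype κ] (G : κ → X → ℝ) :
    ℕ → (ι : Type) → [Fintype ι] → (ι → X → ℝ) → Prop
  | refl : Computes w B G 0 κ G
  | head {ℓ : ℕ} {ι ι' : Type} [Fintype ι] [Fintype ι'] (F : ι → X → ℝ) (F' : ι' → X → ℝ) :
      Fintype.card ι' ≤ w → (∀ j, Neuron B F (F' j)) → Computes w B G ℓ ι' F' →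
      Computes w B G (ℓ + 1) ι F

namespace Computes

variable {ι κ μ ι' κ' : Type} [Fintype ι] [Fintype κ] [Fintype μ] [Fintype ι'] [Fintype κ']
  {w w' ℓ ℓ' : ℕ} {B B' : ℝ} {F : ι → X → ℝ} {G : κ → X → ℝ} {H : μ → X → ℝ}
  {F' : ι' → X → ℝ} {G' : κ' → X → ℝ}

theorem layer (hw : Fintype.card κ ≤ w) (h : ∀ j, Neuron B F (G j)) : Computes w B G 1 ι F :=
  head F G hw h refl

theorem trans (h : Computes w B G ℓ ι F) (h' : Computes w B H ℓ' κ G) :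
    Computes w B H (ℓ + ℓ') ι F := by
  induction h with
  | refl => simpa using h'
  | head F F' hw hn _ ih =>
    rw [Nat.add_right_comm]
    exact head F F' hw hn ih

theorem mono (h : Computes w B G ℓ ι F) (hw : w ≤ w') (hB : B ≤ B') : Computes w' B' G ℓ ι F := by
  induction h with
  | refl => exact refl
  | head F F' hw' hn _ ih => exact head F F' (hw'.trans hw) (fun j => (hn j).mono hB) ih

theorem cast (h : Computes w B G ℓ ι F) (e : ℓ = ℓ') : Computes w B G ℓ' ι F := e ▸ h

theorem carry (hB : 1 ≤ B) (hw : Fintype.card ι ≤ w) (h0 : ∀ i x, 0 ≤ F i x) (ℓ : ℕ) :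
    Computes w B F ℓ ι F := by
  induction ℓ with
  | zero => exact refl
  | succ ℓ ih => exact head F F hw (fun j => Neuron.coord hB j (h0 j)) ih

theorem parallel (hB : 0 ≤ B) (h : Computes w B G ℓ ι F) (h' : Computes w' B G' ℓ ι' F') :
    Computes (w + w') B (Sum.elim G G') ℓ (ι ⊕ ι') (Sum.elim F F') := by
  induction h generalizing ι' with
  | refl => cases h' with | refl => exact refl
  | head F₁ F₂ hw hn _ ih =>
    cases h' with
    | head _ F₂' hw' hn' h'' =>
      refine head _ (Sum.elim F₂ F₂') ?_ ?_ (ih h'')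
      · rw [Fintype.card_sum]; exact add_le_add hw hw'
      · rintro (j | j)
        · exact (hn j).inl hB _
        · exact (hn' j).inr hB _

theorem iterate {S : ℕ → ι → X → ℝ} (h : ∀ k, Computes w B (S (k + 1)) ℓ ι (S k)) (n : ℕ) :
    Computes w B (S n) (n * ℓ) ι (S 0) := by
  induction n with
  | zero => exact (refl : Computes w B (S 0) 0 ι (S 0)).cast (by simp)
  | succ n ih => exact (ih.trans (h n)).cast (by ring)

theorem rescale (hB : 1 ≤ B) (h : Computes w B G ℓ ι F) (c : ℝ) (hc : 0 < c) (hc1 : c ≤ 1) :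
    Computes w 1 (fun j x => c * (B ^ ℓ)⁻¹ * G j x) ℓ ι (fun i x => c * F i x) := by
  have hB0 : 0 < B := by linarith
  induction h generalizing c with
  | refl => simpa using (refl : Computes w 1 (fun j x => c * G j x) 0 κ _)
  | @head ℓ ι ι' _ _ F F' hw hn _ ih =>
    have key : (fun j x => c * (B ^ (ℓ + 1))⁻¹ * G j x)
        = fun j x => (c * B⁻¹) * (B ^ ℓ)⁻¹ * G j x := by
      funext j x; rw [pow_succ, mul_inv]; ring
    have hcB : c * B⁻¹ ≤ 1 := by
      rw [← div_eq_mul_inv, div_le_one hB0]; linarith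
    rw [key]
    refine head _ (fun j x => c * B⁻¹ * F' j x) hw ?_ (ih _ (by positivity) hcB)
    intro j
    obtain ⟨g, ⟨a, b, ha, hb, hg⟩, hF'⟩ := hn j
    refine ⟨fun x => c * B⁻¹ * g x, ⟨fun i => a i / B, c * B⁻¹ * b, ?_, ?_, ?_⟩, ?_⟩
    · intro i
      rw [abs_div, abs_of_pos hB0, div_le_one hB0]; exact ha i
    · rw [abs_mul, abs_mul, abs_of_pos hc, abs_of_pos (inv_pos.2 hB0), mul_assoc,
        ← div_eq_inv_mul]
      have : |b| / B ≤ 1 := (div_le_one hB0).2 hb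
      have h0 : 0 ≤ |b| / B := by positivity
      nlinarith
    · intro x
      simp only [hg, mul_add, mul_sum]
      congr 1
      refine sum_congr rfl fun i _ => ?_
      field_simp
    · intro x
      simp only [hF']
      rw [mul_max_of_nonneg _ _ (by positivity), mul_zero]

end Computes

end ReLUApprox

namespace ReLUNet

variable {d d' : ℕ}

/-- The forward pass with the activation applied to the input as well. -/
def actForward (Φ : ReLUNet d) : (i : ℕ) → (Fin (Φ.width 0) → ℝ) → Fin (Φ.width i) → ℝ
  | 0, x => x
  | i + 1, x => Φ.layer i fun k => max (Φ.actForward i x k) 0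

/-- The realization with the activation applied to the input as well. -/
def actRealization (Φ : ReLUNet d) (x : Fin d → ℝ) : ℝ :=
  Φ.actForward Φ.depth (fun k => x (Fin.cast Φ.width_in k)) (Fin.cast Φ.width_out.symm 0)

theorem forward_eq_actForward (Φ : ReLUNet d) (i : ℕ) (x : Fin (Φ.width 0) → ℝ)
    (hx : ∀ k, 0 ≤ x k) : Φ.forward i x = Φ.actForward i x := by
  induction i with
  | zero => rfl
  | succ i ih =>
    rw [forward, actForward, ih]
    congr 1
    funext k
    split_ifs with h
    · subst h
      exact (max_eq_left (hx k)).symm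
    · rfl

theorem realization_eq_actRealization (Φ : ReLUNet d) (x : Fin d → ℝ) (hx : ∀ k, 0 ≤ x k) :
    Φ.realization x = Φ.actRealization x := by
  rw [realization, actRealization, forward_eq_actForward]
  exact fun k => hx _

/-- The network with a single affine layer. -/
def affine (a : Fin d → ℝ) (b : ℝ) : ReLUNet d where
  depth := 1
  depth_pos := one_pos
  width
    | 0 => d
    | _ + 1 => 1
  width_in := rfl
  width_out := rfl
  A
    | 0 => fun _ k => a k
    | _ + 1 => 0
  b
    | 0 => fun _ => b
    | _ + 1 => 0

theorem affine_actRealization (a : Fin d → ℝ) (b : ℝ) (x : Fin d → ℝ) :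
    (affine a b).actRealization x = ∑ k, a k * max (x k) 0 + b := rfl

/-- Prepend an affine layer to a network. -/
def cons (A₀ : Fin d' → Fin d → ℝ) (b₀ : Fin d' → ℝ) (Φ : ReLUNet d') : ReLUNet d where
  depth := Φ.depth + 1
  depth_pos := Nat.succ_pos _
  width
    | 0 => d
    | i + 1 => Φ.width i
  width_in := rfl
  width_out := Φ.width_out
  A
    | 0 => fun j k => A₀ (Fin.cast Φ.width_in j) k
    | i + 1 => Φ.A i
  b
    | 0 => fun j => b₀ (Fin.cast Φ.width_in j)
    | i + 1 => Φ.b i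

theorem cons_actForward (A₀ : Fin d' → Fin d → ℝ) (b₀ : Fin d' → ℝ) (Φ : ReLUNet d') (i : ℕ)
    (x : Fin d → ℝ) :
    (cons A₀ b₀ Φ).actForward (i + 1) x = Φ.actForward i
      (fun j => ∑ k, A₀ (Fin.cast Φ.width_in j) k * max (x k) 0 + b₀ (Fin.cast Φ.width_in j)) := by
  induction i with
  | zero => rfl
  | succ i ih =>
    exact congrArg (fun y => Φ.layer i fun k => max (y k) 0) ih

theorem cons_actRealization (A₀ : Fin d' → Fin d → ℝ) (b₀ : Fin d' → ℝ) (Φ : ReLUNet d')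
    (x : Fin d → ℝ) :
    (cons A₀ b₀ Φ).actRealization x
      = Φ.actRealization fun j => ∑ k, A₀ j k * max (x k) 0 + b₀ j :=
  congrFun (cons_actForward A₀ b₀ Φ Φ.depth x) _

end ReLUNet

namespace ReLUApprox

open Finset

variable {X : Type}

theorem Computes.exists_net {ι κ : Type} [Fintype ι] [Fintype κ] {w ℓ : ℕ} {F : ι → X → ℝ}
    {G : κ → X → ℝ} {out : X → ℝ} (h : Computes w 1 G ℓ ι F) (hw : 1 ≤ w)
    (ho : AffineIn 1 G out) (e : Fin (Fintype.card ι) ≃ ι) :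
    ∃ Φ : ReLUNet (Fintype.card ι), Φ.depth = ℓ + 1 ∧ (∀ i, Φ.width (i + 1) ≤ w) ∧ Φ.magLe 1 ∧
      ∀ x y, (∀ k, max (y k) 0 = F (e k) x) → Φ.actRealization y = out x := by
  induction h with
  | refl =>
    obtain ⟨a, b, ha, hb, hg⟩ := ho
    refine ⟨ReLUNet.affine (fun k => a (e k)) b, rfl, fun i => hw, ?_, ?_⟩
    · rintro i hi
      obtain rfl : i = 0 := Nat.lt_one_iff.1 hi
      exact ⟨fun j k => ha _, fun j => hb⟩
    · intro x y hy
      rw [ReLUNet.affine_actRealization, hg]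
      simp only [hy]
      congr 1
      exact e.sum_comp fun i => a i * G i x
  | @head ℓ ι ι' _ _ F F' hw' hn _ ih =>
    let e' : Fin (Fintype.card ι') ≃ ι' := (Fintype.equivFin ι').symm
    obtain ⟨Φ, hd, hΦw, hm, hΦ⟩ := ih e'
    choose g hg hF' using hn
    choose a b ha hb hg using hg
    refine ⟨ReLUNet.cons (fun j k => a (e' j) (e k)) (fun j => b (e' j)) Φ, ?_, ?_, ?_, ?_⟩
    · exact congrArg (· + 1) hd
    · rintro (_ | i)
      · exact (Φ.width_in.trans_le hw' :)
      · exact hΦw i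
    · rintro (_ | i) hi
      · exact ⟨fun j k => ha _ _, fun j => hb _⟩
      · exact hm i (Nat.lt_of_succ_lt_succ hi)
    · intro x y hy
      rw [ReLUNet.cons_actRealization]
      refine hΦ x _ fun k => ?_
      rw [hF', hg]
      simp only [hy]
      congr 2
      exact e.sum_comp fun i => a (e' k) i * F i x

/-- Replicating a nonnegative neuron multiplies it by `w` per layer, with unit weights. -/
theorem Computes.amplify_width {w : ℕ} (v : X → ℝ) (hv : ∀ x, 0 ≤ v x) (n : ℕ) :
    Computes w 1 (fun (_ : Fin w) x => (w : ℝ) ^ n * v x) (n + 1) Unit (fun _ => v) := by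
  have h1 : Computes w 1 (fun (_ : Fin w) x => (w : ℝ) ^ 0 * v x) 1 Unit (fun _ => v) := by
    refine Computes.layer (by simp) fun j => ?_
    simpa using Neuron.coord (F := fun _ : Unit => v) le_rfl () (fun x => hv x)
  have h2 := Computes.iterate (w := w) (B := 1) (ℓ := 1)
    (S := fun n (_ : Fin w) x => (w : ℝ) ^ n * v x) (fun k => by
      refine Computes.layer (by simp) fun j => Neuron.of_nonneg ?_ fun x => ?_
      · refine ⟨fun _ => 1, 0, by simp, by simp, fun x => ?_⟩
        simp [pow_succ]
        ring
      · have := hv x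
        positivity) n
  exact (h1.trans h2).cast (by ring)

/-- Large weights can be traded for depth. -/
theorem Computes.exists_unit_weight_net {w w₀ c ℓ : ℕ} (hw : 1 ≤ w₀) (hw' : w₀ ≤ w)
    {u v : X → ℝ} (hu : ∀ x, 0 ≤ u x) (hv : ∀ x, 0 ≤ v x) (b : ℝ) (hb : |b| ≤ 1)
    (h : Computes w ((w₀ : ℝ) ^ c) (fun _ : Unit => v) ℓ Unit (fun _ => u)) :
    ∃ Φ : ReLUNet 1, Φ.widthLe w ∧ Φ.depth = ℓ + (c * ℓ + 1) + 1 ∧ Φ.magLe 1 ∧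
      ∀ x, Φ.realization (fun _ => u x) = v x + b := by
  have hw1 : (1 : ℝ) ≤ w₀ := by exact_mod_cast hw
  have h1 := h.rescale (one_le_pow₀ hw1) 1 one_pos le_rfl
  have h2 := Computes.amplify_width (w := w₀) (fun x => 1 * (((w₀ : ℝ) ^ c) ^ ℓ)⁻¹ * v x)
    (fun x => by have := hv x; positivity) (c * ℓ)
  have h3 := h1.trans (h2.mono hw' le_rfl)
  simp only [one_mul] at h3
  obtain ⟨Φ, hd, hΦw, hm, hΦ⟩ := h3.exists_net (out := fun x => v x + b) (hw.trans hw') (by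
    refine ⟨fun _ => (w₀ : ℝ)⁻¹, b, fun _ => ?_, hb, fun x => ?_⟩
    · rw [abs_of_nonneg (by positivity)]
      exact inv_le_one_of_one_le₀ hw1
    · have : (w₀ : ℝ) ≠ 0 := by positivity
      simp only [sum_const, card_univ, Fintype.card_fin, nsmul_eq_mul, ← pow_mul]
      field_simp) (Fintype.equivFin Unit).symm
  refine ⟨Φ, ?_, hd, hm, fun x => ?_⟩
  · rintro (_ | i) _
    · rw [Φ.width_in]
      exact hw.trans hw'
    · exact hΦw i
  · exact (ReLUNet.realization_eq_actRealization (d := Fintype.card Unit) Φ _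
      fun _ => hu x).trans (hΦ x _ fun k => max_eq_left (hu x))

/-- The four ReLU units making up a trapezoid with ramps of width `θ`. -/
def trapNode (θ : ℝ) (p : Fin 4) (z : ℝ) : ℝ := max (z - ![0, θ, 1 - θ, 1] p) 0

/-- The trapezoid supported on `[0, 1]` and equal to `1` on `[θ, 1 - θ]`. -/
def trap (θ z : ℝ) : ℝ :=
  θ⁻¹ * (trapNode θ 0 z - trapNode θ 1 z - trapNode θ 2 z + trapNode θ 3 z)

theorem trap_eq_one {θ z : ℝ} (hθ : 0 < θ) (h : θ ≤ z) (h' : z ≤ 1 - θ) : trap θ z = 1 := by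
  simp only [trap, trapNode, Matrix.cons_val]
  rw [max_eq_left (by linarith), max_eq_left (by linarith), max_eq_right (by linarith),
    max_eq_right (by linarith)]
  field_simp
  ring

theorem trap_eq_zero_of_nonpos {θ z : ℝ} (hθ : 0 < θ) (hθ' : θ ≤ 1) (h : z ≤ 0) :
    trap θ z = 0 := by
  simp only [trap, trapNode, Matrix.cons_val]
  rw [max_eq_right (by linarith), max_eq_right (by linarith), max_eq_right (by linarith),
    max_eq_right (by linarith)]
  ring

theorem trap_eq_zero_of_one_le {θ z : ℝ} (hθ : 0 < θ) (hθ' : θ ≤ 1) (h : 1 ≤ z) :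
    trap θ z = 0 := by
  simp only [trap, trapNode, Matrix.cons_val]
  rw [max_eq_left (by linarith), max_eq_left (by linarith), max_eq_left (by linarith),
    max_eq_left (by linarith)]
  ring

theorem trap_sub_nat {θ z : ℝ} {i j : ℕ} (hθ : 0 < θ) (hθ' : θ ≤ 1) (h : i + θ ≤ z)
    (h' : z ≤ i + (1 - θ)) : trap θ (z - j) = if j = i then 1 else 0 := by
  split_ifs with hij
  · subst hij
    exact trap_eq_one hθ (by linarith) (by linarith)
  · rcases Nat.lt_or_gt_of_ne hij with hlt | hlt
    · have : (j : ℝ) + 1 ≤ i := by exact_mod_cast hlt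
      exact trap_eq_zero_of_one_le hθ hθ' (by linarith)
    · have : (i : ℝ) + 1 ≤ j := by exact_mod_cast hlt
      exact trap_eq_zero_of_nonpos hθ hθ' (by linarith)

section Layers

variable {X ι : Type} [Fintype ι] {B : ℝ} {F : ι → X → ℝ} {z : X → ℝ} {θ : ℝ}

theorem AffineIn.trapNode_neuron (hθ : 0 < θ) (hθ' : θ ≤ 1) (h : AffineIn B F z) (p : Fin 4) :
    Neuron (B + 1) F fun x => trapNode θ p (z x) := by
  refine Neuron.relu ((h.sub (AffineIn.const F _)).mono ?_)
  gcongr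
  fin_cases p <;> simp [abs_le] <;> constructor <;> linarith

theorem AffineIn.trap (hθ : 0 < θ) (h : ∀ p, AffineIn 1 F fun x => trapNode θ p (z x)) :
    AffineIn (4 * θ⁻¹) F fun x => trap θ (z x) := by
  refine ((((h 0).sub (h 1)).sub (h 2)).add (h 3)).smul θ⁻¹ |>.congr ?_ fun x => rfl
  rw [abs_of_pos (inv_pos.2 hθ)]
  linarith

end Layers

variable {w : ℕ}

/-- The smoothed indicator of `w * y ∈ [i, i + 1]`. -/
def oneHot (w : ℕ) (y : ℝ) (i : ℕ) : ℝ := trap (8 * w : ℝ)⁻¹ (w * y - i)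

/-- The value selected in column `j` by the coarse position of `y`. -/
def memRow (V : Fin w → Fin w → ℝ) (y : ℝ) (j : Fin w) : ℝ :=
  max (∑ i, V i j * oneHot w y i) 0

/-- The position of `y` inside its coarse cell. -/
def memPos (w : ℕ) (y : ℝ) : ℝ := w * y - ∑ i : Fin w, (i : ℝ) * oneHot w y i

/-- A function returning the table entry `V i j` when `y` is well inside the cell
number `i * w + j` of a uniform partition of `[0, 1]` into `w²` cells. -/
def memBlock (V : Fin w → Fin w → ℝ) (y : ℝ) : ℝ :=
  ∑ j : Fin w, max (memRow V y j + trap 8⁻¹ (w * memPos w y - (j : ℕ)) - 1) 0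

theorem memBlock_nonneg (V : Fin w → Fin w → ℝ) (y : ℝ) : 0 ≤ memBlock V y :=
  sum_nonneg fun _ _ => le_max_right _ _

theorem inv_eight_mul_le_one (hw : 0 < w) : (8 * w : ℝ)⁻¹ ≤ 1 := by
  have : (1 : ℝ) ≤ w := by exact_mod_cast hw
  exact inv_le_one_of_one_le₀ (by linarith)

theorem memBlock_zero (hw : 0 < w) (V : Fin w → Fin w → ℝ) : memBlock V 0 = 0 := by
  have hw' : (0 : ℝ) < w := by exact_mod_cast hw
  have h : ∀ i : ℕ, oneHot w 0 i = 0 := fun i =>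
    trap_eq_zero_of_nonpos (by positivity) (inv_eight_mul_le_one hw) (by
      have : (0 : ℝ) ≤ i := Nat.cast_nonneg i
      linarith)
  refine sum_eq_zero fun j _ => ?_
  have h' : trap 8⁻¹ (w * memPos w 0 - (j : ℕ)) = 0 :=
    trap_eq_zero_of_nonpos (by norm_num) (by norm_num) (by simp [memPos, h])
  simp [memRow, h, h']

theorem memBlock_one (hw : 0 < w) (V : Fin w → Fin w → ℝ) : memBlock V 1 = 0 := by
  have hw' : (1 : ℝ) ≤ w := by exact_mod_cast hw
  have h : ∀ i : Fin w, oneHot w 1 i = 0 := fun i =>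
    trap_eq_zero_of_one_le (by positivity) (inv_eight_mul_le_one hw) (by
      have : ((i : ℕ) : ℝ) + 1 ≤ w := by exact_mod_cast i.2
      linarith)
  refine sum_eq_zero fun j _ => ?_
  have h' : trap 8⁻¹ (w * memPos w 1 - (j : ℕ)) = 0 :=
    trap_eq_zero_of_one_le (by norm_num) (by norm_num) (by
      have : ((j : ℕ) : ℝ) + 1 ≤ w := by exact_mod_cast j.2
      simp only [memPos, h]
      simp
      nlinarith)
  simp [memRow, h, h']

theorem memBlock_eq (V : Fin w → Fin w → ℝ) (hV : ∀ i j, 0 ≤ V i j)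
    (hV' : ∀ i j, V i j ≤ 1) (i j : Fin w) {y : ℝ}
    (h : (i : ℕ) * (w : ℝ) + (j : ℕ) + 8⁻¹ ≤ w * (w * y))
    (h' : w * (w * y) ≤ (i : ℕ) * (w : ℝ) + (j : ℕ) + (1 - 8⁻¹)) : memBlock V y = V i j := by
  have hw : 0 < w := i.pos
  have hw' : (1 : ℝ) ≤ w := by exact_mod_cast hw
  have hj : ((j : ℕ) : ℝ) + 1 ≤ w := by exact_mod_cast j.2
  have hj0 : (0 : ℝ) ≤ (j : ℕ) := Nat.cast_nonneg _
  have hinv : (w : ℝ) * (8 * w : ℝ)⁻¹ = 8⁻¹ := by field_simp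
  have hot : ∀ k : Fin w, oneHot w y k = if k = i then 1 else 0 := fun k => by
    rw [oneHot, trap_sub_nat (i := i) (by positivity) (inv_eight_mul_le_one hw)]
    · simp [Fin.ext_iff]
    · refine le_of_mul_le_mul_left (a := (w : ℝ)) ?_ (by linarith)
      rw [mul_add, hinv]; linarith
    · refine le_of_mul_le_mul_left (a := (w : ℝ)) ?_ (by linarith)
      rw [mul_add, mul_sub, hinv]; linarith
  have hpos : w * memPos w y = w * (w * y) - (i : ℕ) * (w : ℝ) := by
    simp only [memPos, hot, mul_ite, mul_one, mul_zero, sum_ite_eq', mem_univ, if_true]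
    ring
  have hrow : ∀ k, memRow V y k = V i k := fun k => by
    simp only [memRow, hot, mul_ite, mul_one, mul_zero, sum_ite_eq', mem_univ, if_true]
    exact max_eq_left (hV i k)
  rw [memBlock, sum_eq_single_of_mem j (mem_univ j)]
  · rw [hrow, hpos, trap_sub_nat (i := j) (by norm_num) (by norm_num) (by linarith)
      (by linarith), if_pos rfl]
    simpa using hV i j
  · intro k _ hk
    rw [hrow, hpos, trap_sub_nat (i := j) (by norm_num) (by norm_num) (by linarith)
      (by linarith), if_neg (fun h => hk (Fin.ext h))]
    simpa using hV' i k

/-- The memory over `n` blocks of `w²` cells each, read at position `s ∈ [0, n]`. -/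
def memory (V : ℕ → Fin w → Fin w → ℝ) (n : ℕ) (s : ℝ) : ℝ :=
  ∑ k ∈ range n, memBlock (V k) (max (s - k) 0 - max (s - k - 1) 0)

theorem memory_nonneg (V : ℕ → Fin w → Fin w → ℝ) (n : ℕ) (s : ℝ) : 0 ≤ memory V n s :=
  sum_nonneg fun _ _ => memBlock_nonneg _ _

theorem memory_eq (V : ℕ → Fin w → Fin w → ℝ) (hV : ∀ k i j, 0 ≤ V k i j)
    (hV' : ∀ k i j, V k i j ≤ 1) {n k : ℕ} (hk : k < n) (i j : Fin w) {s : ℝ}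
    (h : k * (w : ℝ) ^ 2 + (i : ℕ) * (w : ℝ) + (j : ℕ) + 8⁻¹ ≤ w ^ 2 * s)
    (h' : w ^ 2 * s ≤ k * (w : ℝ) ^ 2 + (i : ℕ) * (w : ℝ) + (j : ℕ) + (1 - 8⁻¹)) :
    memory V n s = V k i j := by
  have hw : 0 < w := i.pos
  have hw' : (0 : ℝ) < (w : ℝ) ^ 2 := by have : (0 : ℝ) < w := by exact_mod_cast hw
                                         positivity
  have hi : ((i : ℕ) : ℝ) + 1 ≤ w := by exact_mod_cast i.2
  have hj : ((j : ℕ) : ℝ) + 1 ≤ w := by exact_mod_cast j.2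
  have hj0 : (0 : ℝ) ≤ (j : ℕ) := Nat.cast_nonneg _
  have hi0 : (0 : ℝ) ≤ (i : ℕ) := Nat.cast_nonneg _
  have hs : (k : ℝ) ≤ s := le_of_mul_le_mul_left (a := (w : ℝ) ^ 2) (by nlinarith) hw'
  have hs' : s ≤ k + 1 := le_of_mul_le_mul_left (a := (w : ℝ) ^ 2) (by nlinarith) hw'
  rw [memory, sum_eq_single_of_mem k (mem_range.2 hk)]
  · rw [max_eq_left (by linarith), max_eq_right (by linarith)]
    refine memBlock_eq (V k) (hV k) (hV' k) i j ?_ ?_ <;> nlinarith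
  · intro l _ hl
    rcases Nat.lt_or_gt_of_ne hl with hlt | hlt
    · have : (l : ℝ) + 1 ≤ k := by exact_mod_cast hlt
      rw [max_eq_left (by linarith), max_eq_left (by linarith)]
      ring_nf
      exact memBlock_one hw _
    · have : (k : ℝ) + 1 ≤ l := by exact_mod_cast hlt
      rw [max_eq_right (by linarith), max_eq_right (by linarith)]
      simpa using memBlock_zero hw (V l)

section Layers

variable {X : Type} {B : ℝ}

theorem computes_memBlock (hw : 4 ≤ w) (hB : 40 * (w : ℝ) ^ 4 ≤ B) (V : Fin w → Fin w → ℝ)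
    (hV : ∀ i j, |V i j| ≤ 1) (Y acc : X → ℝ) (hY : ∀ x, 0 ≤ Y x) (hacc : ∀ x, 0 ≤ acc x) :
    Computes (6 * w) B
      ![fun x => max (Y x - 1) 0, fun x => acc x + memBlock V (Y x - max (Y x - 1) 0)]
      5 (Fin 2) ![Y, acc] := by
  have hw4 : (4 : ℝ) ≤ w := by exact_mod_cast hw
  have e1 : (1 : ℝ) ≤ (w : ℝ) ^ 4 := one_le_pow₀ (by linarith)
  have e2 : (w : ℝ) ≤ (w : ℝ) ^ 4 := le_self_pow₀ (by linarith) (by norm_num)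
  have e3 : (w : ℝ) ^ 2 ≤ (w : ℝ) ^ 4 := pow_le_pow_right₀ (by linarith) (by norm_num)
  have hB1 : 1 ≤ B := by linarith
  set Y' : X → ℝ := fun x => max (Y x - 1) 0 with hY'
  have hY'0 : ∀ x, 0 ≤ Y' x := fun x => le_max_right _ _
  have hYY' : ∀ x, 0 ≤ Y x - Y' x := fun x =>
    sub_nonneg.2 (max_le (by linarith) (hY x))
  let F₁ : Fin 3 → X → ℝ := ![Y', Y, acc]
  let F₂ : (Fin w × Fin 4) ⊕ Fin 3 → X → ℝ :=
    Sum.elim (fun ip x => trapNode (8 * w : ℝ)⁻¹ ip.2 (w * (Y x - Y' x) - (ip.1 : ℕ)))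
      ![Y', fun x => Y x - Y' x, acc]
  let F₃ : (Fin w × Fin 4) ⊕ (Fin w ⊕ Fin 2) → X → ℝ :=
    Sum.elim (fun jp x => trapNode 8⁻¹ jp.2 (w * memPos w (Y x - Y' x) - (jp.1 : ℕ)))
      (Sum.elim (fun j x => memRow V (Y x - Y' x) j) ![Y', acc])
  let F₄ : Fin w ⊕ Fin 2 → X → ℝ :=
    Sum.elim (fun j x => max (memRow V (Y x - Y' x) j
      + trap 8⁻¹ (w * memPos w (Y x - Y' x) - (j : ℕ)) - 1) 0) ![Y', acc]
  have hθ : (0 : ℝ) < (8 * w : ℝ)⁻¹ := by positivity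
  have l1 : ∀ j, Neuron B ![Y, acc] (F₁ j) := by
    intro j
    fin_cases j
    · exact Neuron.relu (((AffineIn.coord ![Y, acc] 0).sub (AffineIn.const _ 1)).mono
        (by simp; linarith))
    · exact Neuron.coord hB1 (0 : Fin 2) hY
    · exact Neuron.coord hB1 (1 : Fin 2) hacc
  have l2 : ∀ j, Neuron B F₁ (F₂ j) := by
    have hy : AffineIn 2 F₁ fun x => Y x - Y' x :=
      ((AffineIn.coord F₁ 1).sub (AffineIn.coord F₁ 0)).congr (by norm_num) fun x => rfl
    rintro (⟨i, p⟩ | j)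
    · have hi : ((i : ℕ) : ℝ) ≤ w := by exact_mod_cast i.2.le
      have := ((hy.smul w).sub (AffineIn.const F₁ (i : ℕ))).trapNode_neuron hθ
        (inv_eight_mul_le_one (by lia)) p
      refine this.mono ?_
      simp only [Nat.abs_cast]
      linarith
    · fin_cases j
      · exact Neuron.coord hB1 (0 : Fin 3) hY'0
      · exact Neuron.of_nonneg (hy.mono (by linarith)) hYY'
      · exact Neuron.coord hB1 (2 : Fin 3) hacc
  have l3 : ∀ j, Neuron B F₂ (F₃ j) := by
    have hhot : ∀ i : Fin w, AffineIn (32 * w) F₂ fun x => oneHot w (Y x - Y' x) i := fun i =>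
      (AffineIn.trap hθ fun p => AffineIn.coord F₂ (Sum.inl (i, p))).congr
        (by rw [inv_inv]; linarith) fun x => rfl
    rintro (⟨j, p⟩ | j | j)
    · have hj : ((j : ℕ) : ℝ) ≤ w := by exact_mod_cast j.2.le
      have hsum : AffineIn (32 * (w : ℝ) ^ 3) F₂
          fun x => ∑ i : Fin w, (i : ℝ) * oneHot w (Y x - Y' x) i := by
        refine (AffineIn.sum_const (C := 32 * (w : ℝ) ^ 2) fun i =>
          ((hhot i).smul (i : ℕ)).mono ?_).mono ?_
        · have hi : ((i : ℕ) : ℝ) ≤ w := by exact_mod_cast i.2.le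
          rw [Nat.abs_cast]
          nlinarith
        · rw [Fintype.card_fin]
          exact le_of_eq (by ring)
      have hpos := ((AffineIn.coord F₂ (Sum.inr 1)).smul w).sub hsum
      have := ((hpos.smul w).sub (AffineIn.const F₂ (j : ℕ))).trapNode_neuron (θ := 8⁻¹) (by norm_num)
        (by norm_num) p
      refine this.mono ?_
      simp only [Nat.abs_cast]
      nlinarith
    · refine Neuron.relu ((AffineIn.sum_const (C := 32 * (w : ℝ)) fun i =>
          ((hhot i).smul (V i j)).mono ?_).mono ?_)
      · have := hV i j
        have h0 : (0 : ℝ) ≤ 32 * w := by positivity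
        nlinarith
      · rw [Fintype.card_fin]
        nlinarith
    · fin_cases j
      · exact Neuron.coord hB1 (Sum.inr (0 : Fin 3) : (Fin w × Fin 4) ⊕ Fin 3) hY'0
      · exact Neuron.coord hB1 (Sum.inr (2 : Fin 3) : (Fin w × Fin 4) ⊕ Fin 3) hacc
  have l4 : ∀ j, Neuron B F₃ (F₄ j) := by
    rintro (j | j)
    · have ht : AffineIn 32 F₃
          fun x => trap 8⁻¹ (w * memPos w (Y x - Y' x) - (j : ℕ)) :=
        (AffineIn.trap (by norm_num) fun p => AffineIn.coord F₃ (Sum.inl (j, p))).congr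
          (by norm_num) fun x => rfl
      refine Neuron.relu ((((AffineIn.coord F₃ (Sum.inr (Sum.inl j))).add ht).sub
        (AffineIn.const F₃ 1)).mono ?_)
      simp
      linarith
    · fin_cases j
      · exact Neuron.coord (F := F₃) hB1 (Sum.inr (Sum.inr 0)) hY'0
      · exact Neuron.coord (F := F₃) hB1 (Sum.inr (Sum.inr 1)) hacc
  have l5 : ∀ j, Neuron B F₄ ((![Y', fun x => acc x + memBlock V (Y x - Y' x)] :
      Fin 2 → X → ℝ) j) := by
    intro j
    fin_cases j
    · exact Neuron.coord (F := F₄) hB1 (Sum.inr 0) hY'0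
    · refine Neuron.of_nonneg (((AffineIn.coord F₄ (Sum.inr 1)).add
        (AffineIn.sum_const fun j : Fin w => AffineIn.coord F₄ (Sum.inl j))).mono ?_)
        fun x => add_nonneg (hacc x) (memBlock_nonneg _ _)
      rw [Fintype.card_fin]
      linarith
  refine .head _ F₁ ?_ l1 (.head _ F₂ ?_ l2 (.head _ F₃ ?_ l3 (.head _ F₄ ?_ l4
    (.layer ?_ l5)))) <;> simp <;> lia

theorem computes_memory (hw : 4 ≤ w) (hB : 40 * (w : ℝ) ^ 4 ≤ B)
    (V : ℕ → Fin w → Fin w → ℝ) (hV : ∀ k i j, |V k i j| ≤ 1) (n : ℕ) (s : X → ℝ) :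
    Computes (6 * w) B (fun (_ : Unit) x => memory V n (s x)) (n * 5 + 2) Unit (fun _ => s) := by
  have hw4 : (4 : ℝ) ≤ w := by exact_mod_cast hw
  have e1 : (1 : ℝ) ≤ (w : ℝ) ^ 4 := one_le_pow₀ (by linarith)
  have hB1 : 1 ≤ B := by linarith
  let S : ℕ → Fin 2 → X → ℝ := fun k => ![fun x => max (s x - k) 0, fun x => memory V k (s x)]
  have hS : ∀ k, Computes (6 * w) B (S (k + 1)) 5 (Fin 2) (S k) := by
    intro k
    have := computes_memBlock hw hB (V k) (hV k) (fun x => max (s x - k) 0)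
      (fun x => memory V k (s x)) (fun x => le_max_right _ _) (fun x => memory_nonneg _ _ _)
    have hmax : ∀ x, max (max (s x - k) 0 - 1) 0 = max (s x - k - 1) 0 := fun x => by
      rcases max_cases (s x - k) 0 with ⟨h, h'⟩ | ⟨h, h'⟩ <;> rw [h]
      rw [max_eq_right (by norm_num), max_eq_right (by linarith)]
    simp only [hmax] at this
    have key : S (k + 1) = ![fun x => max (s x - k - 1) 0, fun x => memory V k (s x)
        + memBlock (V k) (max (s x - k) 0 - max (s x - k - 1) 0)] := by
      funext j x
      fin_cases j
      · simp [S, sub_sub]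
      · simp [S, memory, sum_range_succ]
    rw [key]
    exact this
  have start : Computes (6 * w) B (S 0) 1 Unit (fun _ => s) := by
    refine .layer (by simp; lia) fun j => ?_
    fin_cases j
    · refine Neuron.relu ((AffineIn.coord (fun _ : Unit => s) ()).congr hB1 fun x => ?_)
      simp
    · refine Neuron.of_nonneg ((AffineIn.const _ 0).congr (by simp; linarith) fun x => ?_)
        fun x => memory_nonneg _ _ _
      simp [S, memory]
  have readOut : Computes (6 * w) B (fun (_ : Unit) x => memory V n (s x)) 1 (Fin 2) (S n) :=
    .layer (by simp; lia) fun _ =>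
      Neuron.coord (F := S n) hB1 1 fun x => memory_nonneg _ _ _
  exact ((start.trans (.iterate hS n)).trans readOut).cast (by ring)

end Layers

/-- The ramp from `0` to `1` on `[0, 1]`. -/
def ramp (z : ℝ) : ℝ := max z 0 - max (z - 1) 0

theorem ramp_nonneg (z : ℝ) : 0 ≤ ramp z :=
  sub_nonneg.2 (max_le_max_right 0 (by linarith))

theorem ramp_le_one (z : ℝ) : ramp z ≤ 1 := by
  rw [ramp, sub_le_iff_le_add]
  exact max_le (by linarith [le_max_left (z - 1) 0]) (by linarith [le_max_right (z - 1) 0])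

theorem ramp_of_nonpos {z : ℝ} (h : z ≤ 0) : ramp z = 0 := by
  rw [ramp, max_eq_right h, max_eq_right (by linarith), sub_zero]

theorem ramp_of_one_le {z : ℝ} (h : 1 ≤ z) : ramp z = 1 := by
  rw [ramp, max_eq_left (by linarith), max_eq_left (by linarith)]
  ring

theorem ramp_max_sub {z c : ℝ} (hc : 0 ≤ c) : ramp (max z 0 - c) = ramp (z - c) := by
  rcases le_total z 0 with h | h
  · rw [max_eq_right h, ramp_of_nonpos (by linarith), ramp_of_nonpos (by linarith)]
  · rw [max_eq_left h]

theorem max_bit_add_ramp {b z : ℝ} (hb : b = 0 ∨ b = 1) :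
    max (b + ramp z - 1) 0 = b * ramp z := by
  rcases hb with rfl | rfl
  · rw [max_eq_right (by linarith [ramp_le_one z]), zero_mul]
  · rw [max_eq_left (by linarith [ramp_nonneg z])]
    ring

/-- The piecewise linear interpolation of a nondecreasing sequence at `T ∈ [j, j + 1]`. -/
theorem sum_sub_mul_ramp_mem {q : ℕ → ℝ} (hq : Monotone q) {K j : ℕ} (hj : j + 1 ≤ K) {T : ℝ}
    (h : j ≤ T) (h' : T ≤ j + 1) :
    q j - q 0 ≤ ∑ i ∈ range K, (q (i + 1) - q i) * ramp (T - i) ∧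
      ∑ i ∈ range K, (q (i + 1) - q i) * ramp (T - i) ≤ q (j + 1) - q 0 := by
  have hb : ∀ i, 0 ≤ q (i + 1) - q i := fun i => sub_nonneg.2 (hq (Nat.le_succ i))
  constructor
  · rw [← sum_range_sub]
    calc ∑ i ∈ range j, (q (i + 1) - q i)
        = ∑ i ∈ range j, (q (i + 1) - q i) * ramp (T - i) := by
          refine sum_congr rfl fun i hi => ?_
          have : (i : ℝ) + 1 ≤ j := by exact_mod_cast mem_range.1 hi
          rw [ramp_of_one_le (by linarith), mul_one]
      _ ≤ _ := sum_le_sum_of_subset_of_nonneg (range_subset_range.2 (by lia))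
          fun i _ _ => mul_nonneg (hb i) (ramp_nonneg _)
  · rw [← sum_range_sub]
    calc ∑ i ∈ range K, (q (i + 1) - q i) * ramp (T - i)
        = ∑ i ∈ range (j + 1), (q (i + 1) - q i) * ramp (T - i) := by
          refine (sum_subset (range_subset_range.2 hj) fun i _ hi => ?_).symm
          have : (j : ℝ) + 1 ≤ i := by exact_mod_cast not_lt.1 (mt mem_range.2 hi)
          rw [ramp_of_nonpos (by linarith), mul_zero]
      _ ≤ _ := sum_le_sum fun i _ => mul_le_of_le_one_right (hb i) (ramp_le_one _)

theorem sum_range_mul_eq (f : ℕ → ℝ) (n m : ℕ) :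
    ∑ i ∈ range (n * m), f i = ∑ k ∈ range n, ∑ e : Fin m, f (k * m + e) := by
  induction n with
  | zero => simp
  | succ n ih =>
    rw [sum_range_succ, ← ih, Nat.succ_mul, sum_range_add,
      Fin.sum_univ_eq_sum_range fun e => f (n * m + e)]

variable {Q m : ℕ}

/-- Removing the leading digit of an encoded digit sequence. -/
def decRest (Q : ℕ) (r : ℝ) : ℝ :=
  max (2 * (Q * r - ∑ d : Fin Q, ((d : ℕ) : ℝ) * trap 4⁻¹ (Q * r - (d : ℕ)) - 4⁻¹)) 0

/-- The sum of the bits, weighted by ramps, stored in the leading digit. -/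
def decGate (β : Fin Q → Fin m → ℝ) (r T : ℝ) : ℝ :=
  ∑ e : Fin m, max (∑ d : Fin Q, β d e * trap 4⁻¹ (Q * r - (d : ℕ)) + ramp (T - (e : ℕ)) - 1) 0

/-- The weighted sum of all bits stored in the first `n` digits. -/
def decode (β : Fin Q → Fin m → ℝ) (n : ℕ) (r T : ℝ) : ℝ :=
  ∑ k ∈ range n, decGate β ((decRest Q)^[k] r) (max (T - k * m) 0)

theorem decGate_nonneg (β : Fin Q → Fin m → ℝ) (r T : ℝ) : 0 ≤ decGate β r T :=
  sum_nonneg fun _ _ => le_max_right _ _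

theorem decode_nonneg (β : Fin Q → Fin m → ℝ) (n : ℕ) (r T : ℝ) : 0 ≤ decode β n r T :=
  sum_nonneg fun _ _ => decGate_nonneg _ _ _

theorem exists_code (hQ : 0 < Q) (n : ℕ) (d : ℕ → Fin Q) : ∃ c : ℕ → ℝ,
    (∀ k, 0 ≤ c k ∧ c k ≤ 1) ∧ ∀ k < n, Q * c k = (d k : ℕ) + 4⁻¹ + c (k + 1) / 2 := by
  have hQ' : (0 : ℝ) < Q := by exact_mod_cast hQ
  induction n generalizing d with
  | zero => exact ⟨0, fun k => by simp, fun k hk => absurd hk (Nat.not_lt_zero k)⟩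
  | succ n ih =>
    obtain ⟨c, h1, h2⟩ := ih fun k => d (k + 1)
    refine ⟨fun k => k.casesOn (((d 0 : ℕ) + 4⁻¹ + c 0 / 2) / Q) c, ?_, ?_⟩
    · rintro (_ | k)
      · have h := h1 0
        have hd : ((d 0 : ℕ) : ℝ) + 1 ≤ Q := by exact_mod_cast (d 0).2
        constructor
        · have := h.1
          show 0 ≤ ((d 0 : ℕ) + 4⁻¹ + c 0 / 2) / (Q : ℝ)
          positivity
        · show ((d 0 : ℕ) + 4⁻¹ + c 0 / 2) / (Q : ℝ) ≤ 1
          rw [div_le_one hQ']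
          linarith [h.2]
      · exact h1 k
    · rintro (_ | k) hk
      · exact mul_div_cancel₀ _ hQ'.ne'
      · exact h2 k (Nat.lt_of_succ_lt_succ hk)

theorem decode_eq {β : Fin Q → Fin m → ℝ} (hβ : ∀ d e, β d e = 0 ∨ β d e = 1) {n : ℕ}
    {d : ℕ → Fin Q} {c : ℕ → ℝ} (hc : ∀ k, 0 ≤ c k ∧ c k ≤ 1)
    (hcd : ∀ k < n, Q * c k = (d k : ℕ) + 4⁻¹ + c (k + 1) / 2) (T : ℝ) :
    decode β n (c 0) T
      = ∑ k ∈ range n, ∑ e : Fin m, β (d k) e * ramp (T - ((k * m + e : ℕ) : ℝ)) := by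
  have ht : ∀ k < n, ∀ e : Fin Q, trap 4⁻¹ (Q * c k - (e : ℕ)) = if e = d k then 1 else 0 := by
    intro k hk e
    have h := hc (k + 1)
    rw [hcd k hk, trap_sub_nat (i := d k) (by norm_num) (by norm_num) (by linarith)
      (by linarith)]
    simp [Fin.ext_iff]
  have hr : ∀ k < n, decRest Q (c k) = c (k + 1) := by
    intro k hk
    simp only [decRest, ht k hk, mul_ite, mul_one, mul_zero, sum_ite_eq', mem_univ, if_true]
    rw [hcd k hk]
    ring_nf
    exact max_eq_left (by linarith [(hc (1 + k)).1])
  have hit : ∀ k ≤ n, (decRest Q)^[k] (c 0) = c k := by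
    intro k
    induction k with
    | zero => intro _; rfl
    | succ k ih =>
      intro hk
      rw [Function.iterate_succ_apply', ih (by lia), hr k (by lia)]
  refine sum_congr rfl fun k hk => ?_
  have hk := mem_range.1 hk
  rw [hit k hk.le]
  refine sum_congr rfl fun e _ => ?_
  simp only [ht k hk, mul_ite, mul_one, mul_zero, sum_ite_eq', mem_univ, if_true]
  rw [max_bit_add_ramp (hβ _ _), ramp_max_sub (Nat.cast_nonneg _)]
  push_cast
  rw [sub_sub]

theorem exists_bit_table (m : ℕ) : ∃ β : Fin (2 ^ m) → Fin m → ℝ,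
    (∀ d e, β d e = 0 ∨ β d e = 1) ∧
      ∀ b : Fin m → ℝ, (∀ e, b e = 0 ∨ b e = 1) → ∃ d, β d = b := by
  classical
  let E : (Fin m → Bool) ≃ Fin (2 ^ m) := Fintype.equivFinOfCardEq (by simp)
  refine ⟨fun d e => if E.symm d e then 1 else 0, fun d e => ?_, fun b hb => ?_⟩
  · by_cases h : E.symm d e = true <;> simp [h]
  · refine ⟨E fun e => decide (b e = 1), funext fun e => ?_⟩
    rcases hb e with h | h <;> simp [h]

/-- Every bit sequence of length `n * m` can be stored in a single number in `[0, 1]`. -/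
theorem exists_decode_eq {β : Fin (2 ^ m) → Fin m → ℝ} (hβ : ∀ d e, β d e = 0 ∨ β d e = 1)
    (hβ' : ∀ b : Fin m → ℝ, (∀ e, b e = 0 ∨ b e = 1) → ∃ d, β d = b) (n : ℕ) (b : ℕ → ℝ)
    (hb : ∀ i, b i = 0 ∨ b i = 1) : ∃ a : ℝ, 0 ≤ a ∧ a ≤ 1 ∧
      ∀ T, decode β n a T = ∑ i ∈ range (n * m), b i * ramp (T - i) := by
  choose d hd using fun k : ℕ => hβ' (fun e => b (k * m + e)) fun e => hb _
  obtain ⟨c, hc, hcd⟩ := exists_code (by positivity) n d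
  refine ⟨c 0, (hc 0).1, (hc 0).2, fun T => ?_⟩
  rw [decode_eq hβ hc hcd, sum_range_mul_eq]
  simp only [hd]

section Layers

variable {X : Type} {B : ℝ} {w : ℕ}

theorem computes_decGate (hw : 4 ≤ w) (hQ : Q ≤ w) (hm : m ≤ w) (hB : 40 * (w : ℝ) ^ 4 ≤ B)
    (β : Fin Q → Fin m → ℝ) (hβ : ∀ d e, |β d e| ≤ 1) (r T acc : X → ℝ) (hr : ∀ x, 0 ≤ r x)
    (hT : ∀ x, 0 ≤ T x) (hacc : ∀ x, 0 ≤ acc x) :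
    Computes (6 * w) B
      ![fun x => decRest Q (r x), fun x => max (T x - m) 0,
        fun x => acc x + decGate β (r x) (T x)]
      3 (Fin 3) ![r, T, acc] := by
  have hw4 : (4 : ℝ) ≤ w := by exact_mod_cast hw
  have hQw : (Q : ℝ) ≤ w := by exact_mod_cast hQ
  have hmw : (m : ℝ) ≤ w := by exact_mod_cast hm
  have hQ0 : (0 : ℝ) ≤ Q := Nat.cast_nonneg _
  have e1 : (1 : ℝ) ≤ (w : ℝ) ^ 4 := one_le_pow₀ (by linarith)
  have e2 : (w : ℝ) ≤ (w : ℝ) ^ 4 := le_self_pow₀ (by linarith) (by norm_num)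
  have e3 : (w : ℝ) ^ 2 ≤ (w : ℝ) ^ 4 := pow_le_pow_right₀ (by linarith) (by norm_num)
  have hQ2 : (Q : ℝ) ^ 2 ≤ (w : ℝ) ^ 2 := by gcongr
  have hB1 : 1 ≤ B := by linarith
  let F₁ : (Fin Q × Fin 4) ⊕ (Fin (m + 1) ⊕ Fin 3) → X → ℝ :=
    Sum.elim (fun ip x => trapNode 4⁻¹ ip.2 (Q * r x - (ip.1 : ℕ)))
      (Sum.elim (fun e x => max (T x - (e : ℕ)) 0) ![r, T, acc])
  let F₂ : Fin m ⊕ Fin 3 → X → ℝ :=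
    Sum.elim (fun e x => max (∑ d : Fin Q, β d e * trap 4⁻¹ (Q * r x - (d : ℕ))
        + ramp (T x - (e : ℕ)) - 1) 0)
      ![fun x => decRest Q (r x), fun x => max (T x - m) 0, acc]
  have l1 : ∀ j, Neuron B ![r, T, acc] (F₁ j) := by
    rintro (⟨i, p⟩ | e | j)
    · have hi : ((i : ℕ) : ℝ) ≤ Q := by exact_mod_cast i.2.le
      refine ((((AffineIn.coord ![r, T, acc] 0).smul Q).sub
        (AffineIn.const _ (i : ℕ))).trapNode_neuron (θ := 4⁻¹) (by norm_num)
        (by norm_num) p).mono ?_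
      simp only [Nat.abs_cast]
      linarith
    · have he : ((e : ℕ) : ℝ) ≤ m := by exact_mod_cast Nat.lt_succ_iff.1 e.2
      refine Neuron.relu (((AffineIn.coord ![r, T, acc] 1).sub
        (AffineIn.const _ (e : ℕ))).mono ?_)
      simp only [Nat.abs_cast]
      linarith
    · fin_cases j
      · exact Neuron.coord hB1 (0 : Fin 3) hr
      · exact Neuron.coord hB1 (1 : Fin 3) hT
      · exact Neuron.coord hB1 (2 : Fin 3) hacc
  have l2 : ∀ j, Neuron B F₁ (F₂ j) := by
    have hhot : ∀ d : Fin Q, AffineIn 16 F₁ fun x => trap 4⁻¹ (Q * r x - (d : ℕ)) := fun d =>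
      (AffineIn.trap (by norm_num) fun p => AffineIn.coord F₁ (Sum.inl (d, p))).congr
        (by norm_num) fun x => rfl
    rintro (e | j)
    · have hbits : AffineIn (16 * (w : ℝ)) F₁
          fun x => ∑ d : Fin Q, β d e * trap 4⁻¹ (Q * r x - (d : ℕ)) := by
        refine (AffineIn.sum_const (C := 16) fun d => ((hhot d).smul (β d e)).mono ?_).mono ?_
        · linarith [hβ d e]
        · rw [Fintype.card_fin]
          linarith
      have hramp : AffineIn 2 F₁ fun x => ramp (T x - (e : ℕ)) := by
        refine ((AffineIn.coord F₁ (Sum.inr (Sum.inl e.castSucc))).sub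
          (AffineIn.coord F₁ (Sum.inr (Sum.inl e.succ)))).congr (by norm_num) fun x => ?_
        simp [F₁, ramp, sub_sub]
      refine Neuron.relu (((hbits.add hramp).sub (AffineIn.const F₁ 1)).mono ?_)
      simp
      linarith
    · fin_cases j
      · have hsum : AffineIn (16 * (w : ℝ) ^ 2) F₁
            fun x => ∑ d : Fin Q, ((d : ℕ) : ℝ) * trap 4⁻¹ (Q * r x - (d : ℕ)) := by
          refine (AffineIn.sum_const (C := 16 * (Q : ℝ)) fun d =>
            ((hhot d).smul (d : ℕ)).mono ?_).mono ?_
          · have hd : ((d : ℕ) : ℝ) ≤ Q := by exact_mod_cast d.2.le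
            rw [Nat.abs_cast]
            linarith
          · rw [Fintype.card_fin]
            nlinarith
        refine Neuron.relu ((((((AffineIn.coord F₁ (Sum.inr (Sum.inr 0))).smul Q).sub hsum).sub
          (AffineIn.const F₁ 4⁻¹)).smul 2).mono ?_)
        rw [Nat.abs_cast, abs_of_pos (by norm_num : (0 : ℝ) < 2),
          abs_of_pos (by norm_num : (0 : ℝ) < 4⁻¹)]
        linarith
      · refine Neuron.relu (((AffineIn.coord F₁ (Sum.inr (Sum.inr 1))).sub
          (AffineIn.const F₁ m)).mono ?_)
        rw [Nat.abs_cast]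
        linarith
      · exact Neuron.coord (F := F₁) hB1 (Sum.inr (Sum.inr 2)) hacc
  have l3 : ∀ j, Neuron B F₂ ((![fun x => decRest Q (r x), fun x => max (T x - m) 0,
      fun x => acc x + decGate β (r x) (T x)] : Fin 3 → X → ℝ) j) := by
    intro j
    fin_cases j
    · exact Neuron.coord (F := F₂) hB1 (Sum.inr 0) fun x => le_max_right _ _
    · exact Neuron.coord (F := F₂) hB1 (Sum.inr 1) fun x => le_max_right _ _
    · refine Neuron.of_nonneg (((AffineIn.coord F₂ (Sum.inr 2)).add
        (AffineIn.sum_const fun e : Fin m => AffineIn.coord F₂ (Sum.inl e))).mono ?_)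
        fun x => add_nonneg (hacc x) (decGate_nonneg _ _ _)
      rw [Fintype.card_fin]
      linarith
  refine .head _ F₁ ?_ l1 (.head _ F₂ ?_ l2 (.layer ?_ l3)) <;> simp <;> lia

theorem computes_decode (hw : 4 ≤ w) (hQ : Q ≤ w) (hm : m ≤ w) (hB : 40 * (w : ℝ) ^ 4 ≤ B)
    (β : Fin Q → Fin m → ℝ) (hβ : ∀ d e, |β d e| ≤ 1) (n : ℕ) (F : Fin 2 → X → ℝ)
    (hF : ∀ i x, 0 ≤ F i x) :
    Computes (6 * w) B (fun (_ : Unit) x => decode β n (F 0 x) (F 1 x)) (n * 3 + 2)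
      (Fin 2) F := by
  have hw4 : (4 : ℝ) ≤ w := by exact_mod_cast hw
  have e1 : (1 : ℝ) ≤ (w : ℝ) ^ 4 := one_le_pow₀ (by linarith)
  have hB1 : 1 ≤ B := by linarith
  let S : ℕ → Fin 3 → X → ℝ := fun k => ![fun x => (decRest Q)^[k] (F 0 x),
    fun x => max (F 1 x - k * m) 0, fun x => decode β k (F 0 x) (F 1 x)]
  have hS : ∀ k, Computes (6 * w) B (S (k + 1)) 3 (Fin 3) (S k) := by
    intro k
    have := computes_decGate hw hQ hm hB β hβ (fun x => (decRest Q)^[k] (F 0 x))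
      (fun x => max (F 1 x - k * m) 0) (fun x => decode β k (F 0 x) (F 1 x)) (fun x => by
        cases k with
        | zero => exact hF 0 x
        | succ k =>
          rw [Function.iterate_succ_apply']
          exact le_max_right _ _)
      (fun x => le_max_right _ _) (fun x => decode_nonneg _ _ _ _)
    have hmax : ∀ z : ℝ, max (max z 0 - m) 0 = max (z - m) 0 := fun z => by
      rcases le_total z 0 with h | h
      · have : (0 : ℝ) ≤ m := Nat.cast_nonneg m
        rw [max_eq_right h, max_eq_right (by linarith), max_eq_right (by linarith)]
      · rw [max_eq_left h]
    have key : S (k + 1) = ![fun x => decRest Q ((decRest Q)^[k] (F 0 x)),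
        fun x => max (max (F 1 x - k * m) 0 - m) 0, fun x => decode β k (F 0 x) (F 1 x)
          + decGate β ((decRest Q)^[k] (F 0 x)) (max (F 1 x - k * m) 0)] := by
      funext j x
      fin_cases j
      · simp [S, Function.iterate_succ_apply']
      · simp [S, hmax, sub_sub, add_mul]
      · simp [S, decode, sum_range_succ]
    rw [key]
    exact this
  have start : Computes (6 * w) B (S 0) 1 (Fin 2) F := by
    refine .layer (by simp; lia) fun j => ?_
    fin_cases j
    · exact Neuron.coord hB1 0 (hF 0)
    · refine Neuron.relu ((AffineIn.coord F 1).congr hB1 fun x => ?_)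
      simp
    · refine Neuron.of_nonneg ((AffineIn.const _ 0).congr (by simp; linarith) fun x => ?_)
        fun x => decode_nonneg _ _ _ _
      simp [S, decode]
  have readOut : Computes (6 * w) B (fun (_ : Unit) x => decode β n (F 0 x) (F 1 x)) 1
      (Fin 3) (S n) :=
    .layer (by simp; lia) fun _ =>
      Neuron.coord (F := S n) hB1 2 fun x => decode_nonneg _ _ _ _
  exact ((start.trans (.iterate hS n)).trans readOut).cast (by ring)

theorem computes_scale (hB : 1 ≤ B) (hw : 1 ≤ w) {n : ℕ} (hn : 1 ≤ n) {c : ℝ} (hc : 0 ≤ c)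
    (hcB : c ≤ B ^ n) (v : X → ℝ) (hv : ∀ x, 0 ≤ v x) :
    Computes w B (fun (_ : Unit) x => c * v x) n Unit (fun _ => v) := by
  have hn' : n ≠ 0 := by lia
  set ρ : ℝ := c ^ (n : ℝ)⁻¹ with hρ
  have hρ0 : 0 ≤ ρ := Real.rpow_nonneg hc _
  have hρn : ρ ^ n = c := Real.rpow_inv_natCast_pow hc hn'
  have hρB : ρ ≤ B := by
    refine le_of_pow_le_pow_left₀ hn' (by linarith) ?_
    rwa [hρn]
  have h := Computes.iterate (w := w) (B := B) (ℓ := 1)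
    (S := fun k (_ : Unit) x => ρ ^ k * v x) (fun k => by
      refine .layer (by simpa using hw) fun j => Neuron.of_nonneg
        (((AffineIn.coord (fun (_ : Unit) x => ρ ^ k * v x) ()).smul ρ).congr ?_ fun x => ?_)
        fun x => ?_
      · rw [abs_of_nonneg hρ0]
        linarith
      · rw [pow_succ]
        ring
      · have := hv x
        positivity) n
  simp only [pow_zero, one_mul, hρn, mul_one] at h
  exact h

end Layers

section Core

variable {X : Type} {w Q m n : ℕ}

theorem pow_six_bounds (hw : 64 ≤ w) :
    40 * (w : ℝ) ^ 4 ≤ (w : ℝ) ^ 6 ∧ 2 * (w : ℝ) ^ 3 ≤ (w : ℝ) ^ 6 ∧ 64 ≤ (w : ℝ) ^ 6 := by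
  have hw' : (64 : ℝ) ≤ w := by exact_mod_cast hw
  have h2 : (40 : ℝ) ≤ (w : ℝ) ^ 2 := by nlinarith
  have h3 : (64 : ℝ) ≤ (w : ℝ) ^ 3 := by nlinarith
  refine ⟨?_, ?_, ?_⟩
  · calc 40 * (w : ℝ) ^ 4 ≤ (w : ℝ) ^ 2 * (w : ℝ) ^ 4 := by gcongr
      _ = _ := by ring
  · calc 2 * (w : ℝ) ^ 3 ≤ (w : ℝ) ^ 3 * (w : ℝ) ^ 3 := by gcongr; linarith
      _ = _ := by ring
  · calc (64 : ℝ) ≤ (w : ℝ) ^ 3 * (w : ℝ) ^ 3 := by nlinarith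
      _ = _ := by ring

theorem computes_core (hw : 64 ≤ w) (hn : 1 ≤ n) (hQ : Q ≤ w) (hm : m ≤ w)
    (β : Fin Q → Fin m → ℝ) (hβ : ∀ d e, |β d e| ≤ 1) (A V P : ℕ → Fin w → Fin w → ℝ)
    (hA : ∀ k i j, |A k i j| ≤ 1) (hV : ∀ k i j, |V k i j| ≤ 1) (hP : ∀ k i j, |P k i j| ≤ 1)
    (r : ℝ) (hr : 0 ≤ r) (hr' : r ≤ 1) (u : X → ℝ) (hu : ∀ x, 0 ≤ u x) :
    Computes (19 * w) ((w : ℝ) ^ 6) (fun (_ : Unit) x => memory V n (n * u x) +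
      r * decode β n (memory A n (n * u x))
        (n * max (m * w ^ 2 * (n * u x - n * memory P n (n * u x))) 0)) (11 * n + 8)
      Unit (fun _ => u) := by
  obtain ⟨hB, hB3, hB1⟩ := pow_six_bounds hw
  have hw' : (64 : ℝ) ≤ w := by exact_mod_cast hw
  have hmw : (m : ℝ) ≤ w := by exact_mod_cast hm
  generalize (w : ℝ) ^ 6 = B at hB hB3 hB1 ⊢
  have hB0 : 1 ≤ B := by linarith
  have hB0' : 0 ≤ B := by linarith
  have hnB : (n : ℝ) ≤ B ^ n :=
    calc (n : ℝ) ≤ 2 ^ n := by exact_mod_cast Nat.lt_two_pow_self.le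
      _ ≤ B ^ n := by gcongr; linarith
  have hn0 : (0 : ℝ) ≤ n := Nat.cast_nonneg n
  have scale : ∀ v : X → ℝ, (∀ x, 0 ≤ v x) →
      Computes 1 B (fun (_ : Unit) x => (n : ℝ) * v x) n Unit fun _ => v :=
    fun v hv => computes_scale hB0 le_rfl hn hn0 hnB v hv
  have carry : ∀ v : X → ℝ, (∀ x, 0 ≤ v x) → ∀ ℓ,
      Computes 1 B (fun _ : Unit => v) ℓ Unit fun _ => v :=
    fun v hv ℓ => Computes.carry hB0 (by simp) (fun _ => hv) ℓ
  set s : X → ℝ := fun x => n * u x with hs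
  have hs0 : ∀ x, 0 ≤ s x := fun x => mul_nonneg hn0 (hu x)
  set a : X → ℝ := fun x => memory A n (s x)
  set v : X → ℝ := fun x => memory V n (s x)
  set p : X → ℝ := fun x => memory P n (s x)
  have ha0 : ∀ x, 0 ≤ a x := fun x => memory_nonneg _ _ _
  have hv0 : ∀ x, 0 ≤ v x := fun x => memory_nonneg _ _ _
  have hp0 : ∀ x, 0 ≤ p x := fun x => memory_nonneg _ _ _
  set d : X → ℝ := fun x => max (m * w ^ 2 * (s x - n * p x)) 0
  have hd0 : ∀ x, 0 ≤ d x := fun x => le_max_right _ _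
  have h1 : Computes (19 * w) B (fun _ : Unit => s) n Unit fun _ => u :=
    (scale u hu).mono (by lia) le_rfl
  have h2 : Computes (19 * w) B
      (Sum.elim (fun _ : Unit => s)
        (Sum.elim (fun _ : Unit => s) (Sum.elim (fun _ : Unit => s) (fun _ : Unit => s)))) 1
      Unit (fun _ => s) := by
    refine Computes.layer (by simp; lia) fun j => ?_
    have : Neuron B (fun _ : Unit => s) s :=
      Neuron.coord (F := fun _ : Unit => s) hB0 () hs0
    rcases j with j | j | j | j <;> exact this
  have h3 : Computes (19 * w) B
      (Sum.elim (fun _ : Unit => a)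
        (Sum.elim (fun _ : Unit => v) (Sum.elim (fun _ : Unit => p) (fun _ : Unit => s))))
      (n * 5 + 2) _ (Sum.elim (fun _ : Unit => s)
        (Sum.elim (fun _ : Unit => s) (Sum.elim (fun _ : Unit => s) (fun _ : Unit => s)))) :=
    ((computes_memory (by lia) hB A hA n s).parallel hB0'
      ((computes_memory (by lia) hB V hV n s).parallel hB0'
        ((computes_memory (by lia) hB P hP n s).parallel hB0' (carry s hs0 _)))).mono
      (by lia) le_rfl
  have h4 : Computes (19 * w) B
      (Sum.elim (fun _ : Unit => a) (Sum.elim (fun _ : Unit => v)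
        (Sum.elim (fun (_ : Unit) x => n * p x) (fun _ : Unit => s)))) n _
      (Sum.elim (fun _ : Unit => a)
        (Sum.elim (fun _ : Unit => v) (Sum.elim (fun _ : Unit => p) (fun _ : Unit => s)))) :=
    ((carry a ha0 n).parallel hB0' ((carry v hv0 n).parallel hB0'
      ((scale p hp0).parallel hB0' (carry s hs0 n)))).mono (by lia) le_rfl
  have h5 : Computes (19 * w) B
      (Sum.elim (fun _ : Unit => a) (Sum.elim (fun _ : Unit => v) (fun _ : Unit => d))) 1 _
      (Sum.elim (fun _ : Unit => a) (Sum.elim (fun _ : Unit => v)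
        (Sum.elim (fun (_ : Unit) x => n * p x) (fun _ : Unit => s)))) := by
    refine Computes.layer (by simp; lia) ?_
    set F := Sum.elim (fun _ : Unit => a) (Sum.elim (fun _ : Unit => v)
        (Sum.elim (fun (_ : Unit) x => n * p x) (fun _ : Unit => s)))
    rintro (_ | _ | _)
    · exact Neuron.coord (F := F) hB0 (Sum.inl ()) ha0
    · exact Neuron.coord (F := F) hB0 (Sum.inr (Sum.inl ())) hv0
    · refine Neuron.relu ((((AffineIn.coord F (Sum.inr (Sum.inr (Sum.inr ())))).sub
        (AffineIn.coord F (Sum.inr (Sum.inr (Sum.inl ()))))).smul (m * w ^ 2)).mono ?_)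
      rw [abs_of_nonneg (by positivity)]
      calc (m * w ^ 2 : ℝ) * (1 + 1) ≤ w * w ^ 2 * (1 + 1) := by gcongr
        _ = 2 * (w : ℝ) ^ 3 := by ring
        _ ≤ B := hB3
  have h6 : Computes (19 * w) B
      (Sum.elim (fun _ : Unit => a) (Sum.elim (fun _ : Unit => v) (fun (_ : Unit) x => n * d x)))
      n _
      (Sum.elim (fun _ : Unit => a) (Sum.elim (fun _ : Unit => v) (fun _ : Unit => d))) :=
    ((carry a ha0 n).parallel hB0' ((carry v hv0 n).parallel hB0' (scale d hd0))).mono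
      (by lia) le_rfl
  have h7 : Computes (19 * w) B (Sum.elim ![a, fun x => n * d x] (fun _ : Unit => v)) 1 _
      (Sum.elim (fun _ : Unit => a)
        (Sum.elim (fun _ : Unit => v) (fun (_ : Unit) x => n * d x))) := by
    refine Computes.layer (by simp; lia) ?_
    set F := Sum.elim (fun _ : Unit => a)
        (Sum.elim (fun _ : Unit => v) (fun (_ : Unit) x => n * d x))
    rintro (i | _)
    · fin_cases i
      · exact Neuron.coord (F := F) hB0 (Sum.inl ()) ha0
      · exact Neuron.coord (F := F) hB0 (Sum.inr (Sum.inr ())) fun x => mul_nonneg hn0 (hd0 x)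
    · exact Neuron.coord (F := F) hB0 (Sum.inr (Sum.inl ())) hv0
  have h8 : Computes (19 * w) B
      (Sum.elim (fun (_ : Unit) x => decode β n (a x) (n * d x)) (fun _ : Unit => v))
      (n * 3 + 2) _ (Sum.elim ![a, fun x => n * d x] (fun _ : Unit => v)) := by
    refine ((computes_decode (by lia) hQ hm hB β hβ n ![a, fun x => n * d x] ?_).parallel hB0'
      (carry v hv0 _)).mono (by lia) le_rfl
    intro i x
    fin_cases i
    · exact ha0 x
    · exact mul_nonneg hn0 (hd0 x)
  have h9 : Computes (19 * w) B
      (fun (_ : Unit) x => v x + r * decode β n (a x) (n * d x)) 1 _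
      (Sum.elim (fun (_ : Unit) x => decode β n (a x) (n * d x)) (fun _ : Unit => v)) := by
    refine Computes.layer (by simp; lia) ?_
    set F := Sum.elim (fun (_ : Unit) x => decode β n (a x) (n * d x)) (fun _ : Unit => v)
    intro _
    refine Neuron.of_nonneg (((AffineIn.coord F (Sum.inr ())).add
      ((AffineIn.coord F (Sum.inl ())).smul r)).mono ?_) fun x =>
        add_nonneg (hv0 x) (mul_nonneg hr (decode_nonneg _ _ _ _))
    rw [abs_of_nonneg hr]
    linarith
  exact ((((((((h1.trans h2).trans h3).trans h4).trans h5).trans h6).trans h7).trans h8).trans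
    h9).cast (by ring)

end Core

section Core

variable {X : Type} {w m n : ℕ}

theorem memory_apply_cell (hw : 0 < w) (f : ℕ → ℝ) (hf : ∀ c, 0 ≤ f c) (hf' : ∀ c, f c ≤ 1)
    {c : ℕ} (hc : c < n * w ^ 2) {s : ℝ} (h : c + 8⁻¹ ≤ w ^ 2 * s)
    (h' : w ^ 2 * s ≤ c + (1 - 8⁻¹)) :
    memory (fun k (i j : Fin w) => f (k * w ^ 2 + i * w + j)) n s = f c := by
  have hc1 : c / w ^ 2 * w ^ 2 + c % w ^ 2 / w * w + c % w ^ 2 % w = c := by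
    rw [add_assoc, Nat.div_add_mod', Nat.div_add_mod']
  have hc2 : ((c / w ^ 2 : ℕ) : ℝ) * (w : ℝ) ^ 2 + ((c % w ^ 2 / w : ℕ) : ℝ) * w
      + ((c % w ^ 2 % w : ℕ) : ℝ) = c := by exact_mod_cast hc1
  have hi : c % w ^ 2 / w < w := by
    rw [Nat.div_lt_iff_lt_mul hw, ← sq]
    exact Nat.mod_lt _ (by positivity)
  have key := memory_eq (fun k (i j : Fin w) => f (k * w ^ 2 + i * w + j)) (fun _ _ _ => hf _)
    (fun _ _ _ => hf' _) (n := n) (k := c / w ^ 2) (s := s)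
    ((Nat.div_lt_iff_lt_mul (by positivity)).2 hc) ⟨c % w ^ 2 / w, hi⟩
    ⟨c % w ^ 2 % w, Nat.mod_lt _ hw⟩ (by simpa only [hc2] using h) (by simpa only [hc2] using h')
  rw [key]
  exact congrArg f hc1

/-- Rounding a monotone `1`-Lipschitz function on a grid of step `1 / N` gives a nondecreasing
integer sequence with increments at most `1`. -/
theorem floor_grid {g : ℝ → ℝ} (hg : Monotone g) (hg' : ∀ x y, x ≤ y → g y - g x ≤ y - x)
    (h0 : ∀ x, 0 ≤ g x) {N : ℝ} (hN : 0 < N) (i : ℕ) :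
    ⌊N * g (i / N)⌋₊ ≤ ⌊N * g ((i + 1 : ℕ) / N)⌋₊ ∧
      ⌊N * g ((i + 1 : ℕ) / N)⌋₊ ≤ ⌊N * g (i / N)⌋₊ + 1 := by
  have hle : (i : ℝ) / N ≤ (i + 1 : ℕ) / N := by gcongr; simp
  constructor
  · exact Nat.floor_mono (mul_le_mul_of_nonneg_left (hg hle) hN.le)
  · rw [← Nat.floor_add_one (mul_nonneg hN.le (h0 _))]
    refine Nat.floor_mono ?_
    have := mul_le_mul_of_nonneg_left (hg' _ _ hle) hN.le
    rw [← sub_div, mul_div_cancel₀ _ hN.ne'] at this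
    push_cast at this ⊢
    linarith

theorem exists_core (hw : 64 ≤ w) (hn : 1 ≤ n) (hm : 1 ≤ m) (hmw : 2 ^ m ≤ w) {g : ℝ → ℝ}
    (hg : Monotone g) (hg' : ∀ x y, x ≤ y → g y - g x ≤ y - x) (h0 : ∀ x, 0 ≤ g x)
    (h1 : ∀ x, g x ≤ 1) (u : X → ℝ) (hu : ∀ x, 0 ≤ u x) :
    ∃ G : X → ℝ, (∀ x, 0 ≤ G x) ∧
      Computes (19 * w) ((w : ℝ) ^ 6) (fun _ : Unit => G) (11 * n + 8) Unit (fun _ => u) ∧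
      ∀ x (c : ℕ), c < n * w ^ 2 → c + 8⁻¹ ≤ n * w ^ 2 * u x →
        n * w ^ 2 * u x ≤ c + (1 - 8⁻¹) →
        |G x - g (u x)| ≤ 2 / (n * w ^ 2 * (n * m)) := by
  have hw0 : (0 : ℝ) < w := by exact_mod_cast (by lia : 0 < w)
  have hn0 : (0 : ℝ) < n := by exact_mod_cast hn
  have hm0 : (0 : ℝ) < m := by exact_mod_cast hm
  have hn1 : (1 : ℝ) ≤ n := by exact_mod_cast hn
  have hm1 : (1 : ℝ) ≤ m := by exact_mod_cast hm
  have hw1 : (1 : ℝ) ≤ w := by exact_mod_cast (by lia : 1 ≤ w)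
  set M : ℝ := n * w ^ 2 with hM
  set K : ℝ := n * m with hK
  have hM0 : 0 < M := by positivity
  have hK0 : 0 < K := by positivity
  set N : ℝ := M * K with hN
  have hN0 : 0 < N := by positivity
  have hN1 : 1 ≤ N := one_le_mul_of_one_le_of_one_le
    (one_le_mul_of_one_le_of_one_le hn1 (one_le_pow₀ hw1))
    (one_le_mul_of_one_le_of_one_le hn1 hm1)
  set q : ℕ → ℕ := fun i => ⌊N * g (i / N)⌋₊
  have hqN : ∀ i : ℕ, (q i : ℝ) ≤ N * g (i / N) := fun i =>
    Nat.floor_le (mul_nonneg hN0.le (h0 _))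
  have hqN' : ∀ i : ℕ, N * g (i / N) < q i + 1 := fun i => Nat.lt_floor_add_one _
  have hq1 : ∀ i, q i ≤ q (i + 1) := fun i => (floor_grid hg hg' h0 hN0 i).1
  have hq2 : ∀ i, q (i + 1) ≤ q i + 1 := fun i => (floor_grid hg hg' h0 hN0 i).2
  obtain ⟨β, hβ, hβ'⟩ := exists_bit_table m
  choose a ha0 ha1 ha using fun c : ℕ => exists_decode_eq hβ hβ' n
    (fun t : ℕ => (q (c * (n * m) + t + 1) : ℝ) - q (c * (n * m) + t)) (by
      intro t
      have e1 := hq1 (c * (n * m) + t)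
      have e2 := hq2 (c * (n * m) + t)
      rcases (by lia : q (c * (n * m) + t + 1) = q (c * (n * m) + t) ∨
        q (c * (n * m) + t + 1) = q (c * (n * m) + t) + 1) with e | e
      · left; rw [e, sub_self]
      · right; rw [e]; push_cast; ring)
  have hab : ∀ {f : ℕ → ℝ}, (∀ c, 0 ≤ f c) → (∀ c, f c ≤ 1) → ∀ c, |f c| ≤ 1 :=
    fun hf hf' c => abs_le.2 ⟨by linarith [hf c], hf' c⟩
  set v : ℕ → ℝ := fun c => N⁻¹ * q (c * (n * m))
  have hv0 : ∀ c, 0 ≤ v c := fun c => by positivity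
  have hv1 : ∀ c, v c ≤ 1 := fun c => by
    change N⁻¹ * (q (c * (n * m)) : ℝ) ≤ 1
    rw [← div_eq_inv_mul, div_le_one hN0]
    exact (hqN _).trans (mul_le_of_le_one_right hN0.le (h1 _))
  set p : ℕ → ℝ := fun c => min (c / M) 1
  have hp0 : ∀ c, 0 ≤ p c := fun c => le_min (by positivity) zero_le_one
  have hp1 : ∀ c, p c ≤ 1 := fun c => min_le_right _ _
  refine ⟨_, ?_, computes_core hw hn hmw (Nat.lt_two_pow_self.le.trans hmw) β
    (fun d e => by rcases hβ d e with h | h <;> simp [h])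
    (fun k i j => a (k * w ^ 2 + i * w + j)) (fun k i j => v (k * w ^ 2 + i * w + j))
    (fun k i j => p (k * w ^ 2 + i * w + j)) (fun _ _ _ => hab ha0 ha1 _)
    (fun _ _ _ => hab hv0 hv1 _) (fun _ _ _ => hab hp0 hp1 _) N⁻¹ (by positivity)
    (inv_le_one_of_one_le₀ hN1) u hu, ?_⟩
  · exact fun x => add_nonneg (memory_nonneg _ _ _)
      (mul_nonneg (by positivity) (decode_nonneg _ _ _ _))
  intro x c hc hl hr
  have e : (w : ℝ) ^ 2 * (n * u x) = M * u x := by rw [hM]; ring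
  have hw0' : 0 < w := by lia
  rw [← e] at hl hr
  rw [memory_apply_cell hw0' a ha0 ha1 hc hl hr, memory_apply_cell hw0' v hv0 hv1 hc hl hr,
    memory_apply_cell hw0' p hp0 hp1 hc hl hr, ha]
  rw [e] at hl hr
  have hcM : (c : ℝ) ≤ M := by rw [hM]; exact_mod_cast hc.le
  have hpc : p c = c / M := min_eq_left ((div_le_one hM0).2 hcM)
  set T : ℝ := K * (M * u x - c) with hT
  have hT0 : 0 ≤ T := mul_nonneg hK0.le (by linarith)
  have hTK : T < K := by nlinarith
  have hTe : (n : ℝ) * max (m * w ^ 2 * (n * u x - n * p c)) 0 = T := by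
    have e' : (n : ℝ) * (m * w ^ 2 * (n * u x - n * (c / M))) = T := by
      rw [hT, hK, hM]; field_simp
    rw [hpc, mul_max_of_nonneg _ _ hn0.le, mul_zero, e', max_eq_left hT0]
  rw [hTe]
  set t : ℕ := ⌊T⌋₊
  have ht : (t : ℝ) ≤ T := Nat.floor_le hT0
  have ht' : T ≤ t + 1 := (Nat.lt_floor_add_one T).le
  have htK : t + 1 ≤ n * m := by
    have : (t : ℝ) < ((n * m : ℕ) : ℝ) := by push_cast; exact ht.trans_lt hTK
    exact_mod_cast this
  obtain ⟨s1, s2⟩ := sum_sub_mul_ramp_mem (q := fun t => (q (c * (n * m) + t) : ℝ))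
    (monotone_nat_of_le_succ fun t => by exact_mod_cast hq1 _) htK ht ht'
  simp only [add_zero, ← add_assoc] at s1 s2
  set D : ℝ := ∑ i ∈ range (n * m),
    ((q (c * (n * m) + i + 1) : ℝ) - q (c * (n * m) + i)) * ramp (T - i)
  have hNu : N * u x = ((c * (n * m) : ℕ) : ℝ) + T := by rw [hT, hN, hK]; push_cast; ring
  have hul : ((c * (n * m) + t : ℕ) : ℝ) / N ≤ u x := by
    rw [div_le_iff₀' hN0, hNu]; push_cast at *; linarith
  have hur : u x ≤ ((c * (n * m) + t + 1 : ℕ) : ℝ) / N := by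
    rw [le_div_iff₀' hN0, hNu]; push_cast at *; linarith
  have g1 := mul_le_mul_of_nonneg_left (hg' _ _ hul) hN0.le
  have g2 := mul_le_mul_of_nonneg_left (hg' _ _ hur) hN0.le
  rw [mul_sub, mul_sub, mul_div_cancel₀ _ hN0.ne', hNu] at g1 g2
  have q1 := hqN' (c * (n * m) + t)
  have q2 := hqN (c * (n * m) + t + 1)
  rw [le_div_iff₀ hN0, ← abs_of_pos hN0, ← abs_mul, abs_of_pos hN0, abs_le]
  have hG : (v c + N⁻¹ * D - g (u x)) * N = q (c * (n * m)) + D - N * g (u x) := by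
    change (N⁻¹ * (q (c * (n * m)) : ℝ) + N⁻¹ * D - g (u x)) * N = _
    field_simp
  rw [hG]
  push_cast at *
  constructor <;> linarith

end Core

/-- The median of three numbers. -/
def median (a b c : ℝ) : ℝ :=
  (a - max (a - b) 0) + max (b + max (a - b) 0 - max (b + max (a - b) 0 - c) 0
    - (a - max (a - b) 0)) 0

theorem abs_median_sub_le {a b c t ε : ℝ}
    (h : (|a - t| ≤ ε ∧ |b - t| ≤ ε) ∨ (|a - t| ≤ ε ∧ |c - t| ≤ ε) ∨
      (|b - t| ≤ ε ∧ |c - t| ≤ ε)) : |median a b c - t| ≤ ε := by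
  unfold median
  simp only [abs_le] at h ⊢
  rcases max_cases (a - b) 0 with ⟨e, _⟩ | ⟨e, _⟩ <;> rw [e] <;>
  rcases max_cases (b + _ - c) 0 with ⟨e, _⟩ | ⟨e, _⟩ <;> rw [e] <;>
  rcases max_cases (b + _ - _ - _) 0 with ⟨e, _⟩ | ⟨e, _⟩ <;> rw [e] <;>
  rcases h with h | h | h <;> constructor <;> linarith

/-- Among the three shifts of `z` by multiples of `1 / 3`, two are well inside an integer cell. -/
theorem exists_two_shifts {z : ℝ} (hz : 0 ≤ z) {p : ℕ → Prop}
    (hp : ∀ i c : ℕ, (c : ℝ) ≤ z + 1 → c + 8⁻¹ ≤ z + i / 3 → z + i / 3 ≤ c + (1 - 8⁻¹) → p i) :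
    (p 0 ∧ p 1) ∨ (p 0 ∧ p 2) ∨ (p 1 ∧ p 2) := by
  have h := Nat.floor_le hz
  have h' := Nat.lt_floor_add_one z
  set c := ⌊z⌋₊
  have q : ∀ i : ℕ, (c : ℝ) + 8⁻¹ ≤ z + i / 3 → z + i / 3 ≤ c + (1 - 8⁻¹) → p i :=
    fun i => hp i c (by linarith)
  have q' : ∀ i : ℕ, (c : ℝ) + 1 + 8⁻¹ ≤ z + i / 3 → z + i / 3 ≤ c + 1 + (1 - 8⁻¹) → p i :=
    fun i h1 h2 => hp i (c + 1) (by push_cast; linarith) (by push_cast; linarith)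
      (by push_cast; linarith)
  rcases lt_or_ge z (c + 8⁻¹) with h1 | h1
  · exact Or.inr (Or.inr ⟨q 1 (by push_cast; linarith) (by push_cast; linarith),
      q 2 (by push_cast; linarith) (by push_cast; linarith)⟩)
  rcases le_or_gt z (c + 13 / 24) with h2 | h2
  · exact Or.inl ⟨q 0 (by push_cast; linarith) (by push_cast; linarith),
      q 1 (by push_cast; linarith) (by push_cast; linarith)⟩
  rcases le_or_gt z (c + (1 - 8⁻¹)) with h3 | h3
  · exact Or.inr (Or.inl ⟨q 0 (by push_cast; linarith) (by push_cast; linarith),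
      q' 2 (by push_cast; linarith) (by push_cast; linarith)⟩)
  · exact Or.inr (Or.inr ⟨q' 1 (by push_cast; linarith) (by push_cast; linarith),
      q' 2 (by push_cast; linarith) (by push_cast; linarith)⟩)

/-- A nondecreasing `1`-Lipschitz reparametrization of `f` which is constant outside the image
of `[0, 1]`. -/
def monotonized (f : ℝ → ℝ) (σ u : ℝ) : ℝ :=
  (f (max 0 (min (2 * u - σ) 1)) + max 0 (min (2 * u - σ) 1) + 2) / 8

section Monotonized

variable {f : ℝ → ℝ}

theorem clamp_mem (t : ℝ) : max 0 (min t 1) ∈ Set.Icc (0 : ℝ) 1 :=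
  ⟨le_max_left _ _, max_le zero_le_one (min_le_right _ _)⟩

theorem monotonized_sub (hf : f ∈ H1) (σ : ℝ) {u u' : ℝ} (h : u ≤ u') :
    0 ≤ monotonized f σ u' - monotonized f σ u ∧
      monotonized f σ u' - monotonized f σ u ≤ u' - u := by
  have hs : 2 * u - σ ≤ 2 * u' - σ := by linarith
  have hl := hf.2.2 _ (clamp_mem (2 * u' - σ)) _ (clamp_mem (2 * u - σ))
  unfold monotonized
  have h1 : max 0 (min (2 * u - σ) 1) ≤ max 0 (min (2 * u' - σ) 1) := by gcongr
  have h2 : max 0 (min (2 * u' - σ) 1) - max 0 (min (2 * u - σ) 1) ≤ 2 * (u' - u) := by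
    rcases max_cases 0 (min (2 * u' - σ) 1) with ⟨e, _⟩ | ⟨e, _⟩ <;>
    rcases max_cases 0 (min (2 * u - σ) 1) with ⟨e', _⟩ | ⟨e', _⟩ <;>
    rcases min_cases (2 * u' - σ) 1 with ⟨e₁, _⟩ | ⟨e₁, _⟩ <;>
    rcases min_cases (2 * u - σ) 1 with ⟨e₂, _⟩ | ⟨e₂, _⟩ <;> linarith
  rw [abs_of_nonneg (sub_nonneg.2 h1), abs_le] at hl
  constructor <;> linarith [hl.1, hl.2]

theorem monotonized_mem (hf : f ∈ H1) (σ u : ℝ) :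
    0 ≤ monotonized f σ u ∧ monotonized f σ u ≤ 1 := by
  have h := abs_le.1 (hf.2.1 _ (clamp_mem (2 * u - σ)))
  have h' := clamp_mem (2 * u - σ)
  unfold monotonized
  constructor <;> linarith [h.1, h.2, h'.1, h'.2]

theorem monotonized_shift (f : ℝ → ℝ) (σ : ℝ) {x : ℝ} (hx : x ∈ Set.Icc (0 : ℝ) 1) :
    monotonized f σ ((x + σ) / 2) = (f x + x + 2) / 8 := by
  have e : 2 * ((x + σ) / 2) - σ = x := by ring
  rw [monotonized, e, min_eq_left hx.2, max_eq_right hx.1]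

end Monotonized

section Combine

variable {X : Type} {w ℓ : ℕ} {B : ℝ}

/-- Assemble three networks on shifted inputs through a median. -/
theorem computes_median (hw : 1 ≤ w) (hB : 64 ≤ B) (x a b c : X → ℝ) (hx : ∀ y, 0 ≤ x y)
    (ha : ∀ y, 0 ≤ a y) (hb : ∀ y, 0 ≤ b y) (hc : ∀ y, 0 ≤ c y) (σ : ℕ → ℝ)
    (hσ : ∀ i, 0 ≤ σ i) (hσ' : ∀ i, σ i ≤ 2)
    (hA : Computes (19 * w) B (fun _ : Unit => a) ℓ Unit fun _ y => (x y + σ 0) / 2)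
    (hB' : Computes (19 * w) B (fun _ : Unit => b) ℓ Unit fun _ y => (x y + σ 1) / 2)
    (hC : Computes (19 * w) B (fun _ : Unit => c) ℓ Unit fun _ y => (x y + σ 2) / 2) :
    Computes (60 * w) B
      (fun (_ : Unit) y => max (8 * median (a y) (b y) (c y) - x y - 1) 0) (ℓ + 5) Unit
      (fun _ => x) := by
  have hB0 : 0 ≤ B := by linarith
  have hB1 : 1 ≤ B := by linarith
  set r₁ : X → ℝ := fun y => max (a y - b y) 0
  set lo : X → ℝ := fun y => a y - r₁ y
  set hi : X → ℝ := fun y => b y + r₁ y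
  set r₂ : X → ℝ := fun y => max (hi y - c y) 0
  set r₃ : X → ℝ := fun y => max (hi y - r₂ y - lo y) 0
  have hr₁ : ∀ y, 0 ≤ r₁ y := fun y => le_max_right _ _
  have hr₂ : ∀ y, 0 ≤ r₂ y := fun y => le_max_right _ _
  have hr₃ : ∀ y, 0 ≤ r₃ y := fun y => le_max_right _ _
  have hlo : ∀ y, 0 ≤ lo y := fun y =>
    sub_nonneg.2 (max_le (by linarith [hb y]) (ha y))
  have hhi : ∀ y, 0 ≤ hi y := fun y => add_nonneg (hb y) (hr₁ y)
  set u : ℕ → X → ℝ := fun i y => (x y + σ i) / 2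
  have h1 : Computes (60 * w) B (Sum.elim (fun _ : Unit => u 0) (Sum.elim (fun _ : Unit => u 1)
      (Sum.elim (fun _ : Unit => u 2) (fun _ : Unit => x)))) 1 Unit (fun _ => x) := by
    refine Computes.layer (by simp; lia) ?_
    have hu : ∀ i, Neuron B (fun _ : Unit => x) (u i) := fun i => by
      refine Neuron.of_nonneg (((AffineIn.coord (fun _ : Unit => x) ()).add
        (AffineIn.const _ (σ i))).smul 2⁻¹ |>.congr ?_ fun y => by simp only [u]; ring)
        fun y => by have := hx y; have := hσ i; positivity
      rw [abs_of_nonneg (hσ i), abs_of_pos (by norm_num)]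
      linarith [hσ' i]
    rintro (_ | _ | _ | _)
    · exact hu 0
    · exact hu 1
    · exact hu 2
    · exact Neuron.coord (F := fun _ : Unit => x) hB1 () hx
  have h2 : Computes (60 * w) B (Sum.elim (fun _ : Unit => a) (Sum.elim (fun _ : Unit => b)
      (Sum.elim (fun _ : Unit => c) (fun _ : Unit => x)))) ℓ _
      (Sum.elim (fun _ : Unit => u 0) (Sum.elim (fun _ : Unit => u 1)
      (Sum.elim (fun _ : Unit => u 2) (fun _ : Unit => x)))) :=
    (hA.parallel hB0 (hB'.parallel hB0 (hC.parallel hB0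
      (Computes.carry (w := w) hB1 (by simpa using hw) (fun _ => hx) ℓ)))).mono (by lia) le_rfl
  have h3 : Computes (60 * w) B ![a, b, c, r₁, x] 1 _
      (Sum.elim (fun _ : Unit => a) (Sum.elim (fun _ : Unit => b)
      (Sum.elim (fun _ : Unit => c) (fun _ : Unit => x)))) := by
    refine Computes.layer (by simp; lia) ?_
    set F := Sum.elim (fun _ : Unit => a) (Sum.elim (fun _ : Unit => b)
      (Sum.elim (fun _ : Unit => c) (fun _ : Unit => x)))
    intro j
    fin_cases j
    · exact Neuron.coord (F := F) hB1 (Sum.inl ()) ha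
    · exact Neuron.coord (F := F) hB1 (Sum.inr (Sum.inl ())) hb
    · exact Neuron.coord (F := F) hB1 (Sum.inr (Sum.inr (Sum.inl ()))) hc
    · exact Neuron.relu (((AffineIn.coord F (Sum.inl ())).sub
        (AffineIn.coord F (Sum.inr (Sum.inl ())))).mono (by linarith))
    · exact Neuron.coord (F := F) hB1 (Sum.inr (Sum.inr (Sum.inr ()))) hx
  have h4 : Computes (60 * w) B ![lo, hi, r₂, x] 1 _ ![a, b, c, r₁, x] := by
    refine Computes.layer (by simp; lia) ?_
    set F := ![a, b, c, r₁, x]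
    intro j
    fin_cases j
    · exact Neuron.of_nonneg (((AffineIn.coord F 0).sub
        (AffineIn.coord F 3)).mono (by linarith)) hlo
    · exact Neuron.of_nonneg (((AffineIn.coord F 1).add
        (AffineIn.coord F 3)).mono (by linarith)) hhi
    · exact Neuron.relu ((((AffineIn.coord F 1).add
        (AffineIn.coord F 3)).sub (AffineIn.coord F 2)).mono (by linarith))
    · exact Neuron.coord (F := F) hB1 4 hx
  have h5 : Computes (60 * w) B ![lo, r₃, x] 1 _ ![lo, hi, r₂, x] := by
    refine Computes.layer (by simp; lia) ?_
    set F := ![lo, hi, r₂, x]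
    intro j
    fin_cases j
    · exact Neuron.coord (F := F) hB1 0 hlo
    · exact Neuron.relu ((((AffineIn.coord F 1).sub
        (AffineIn.coord F 2)).sub (AffineIn.coord F 0)).mono (by linarith))
    · exact Neuron.coord (F := F) hB1 3 hx
  have h6 : Computes (60 * w) B
      (fun (_ : Unit) y => max (8 * median (a y) (b y) (c y) - x y - 1) 0) 1 _ ![lo, r₃, x] := by
    refine Computes.layer (by simp; lia) ?_
    set F := ![lo, r₃, x]
    intro j
    refine Neuron.relu (((((AffineIn.coord F 0).add (AffineIn.coord F 1)).smul 8).sub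
      (AffineIn.coord F 2)).sub (AffineIn.const F 1) |>.mono ?_)
    norm_num
    linarith
  exact (((((h1.trans h2).trans h3).trans h4).trans h5).trans h6).cast (by ring)

end Combine

/-- Networks with unit weights approximating a `1`-Lipschitz function. -/
theorem exists_net_of_mem_H1 {f : ℝ → ℝ} (hf : f ∈ H1) {w n m : ℕ} (hw : 64 ≤ w) (hn : 1 ≤ n)
    (hm : 1 ≤ m) (hmw : 2 ^ m ≤ w) :
    ∃ Φ : ReLUNet 1, Φ.widthLe (60 * w) ∧ Φ.depth ≤ 300 * n ∧ Φ.magLe 1 ∧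
      ∀ x ∈ Set.Icc (0 : ℝ) 1,
        |Φ.realization (fun _ => x) - f x| ≤ 16 / (n * w ^ 2 * (n * m)) := by
  have hw0 : (64 : ℝ) ≤ w := by exact_mod_cast hw
  have hn0 : (1 : ℝ) ≤ n := by exact_mod_cast hn
  set M : ℝ := n * w ^ 2 with hM
  have hM4 : 4 ≤ M := by nlinarith
  set σ : ℕ → ℝ := fun i => if i ≤ 2 then 2 * (i / 3 : ℝ) / M else 0
  have hσ : ∀ i, 0 ≤ σ i := fun i => by
    simp only [σ]; split_ifs <;> positivity
  have hσ' : ∀ i, σ i ≤ 2 := fun i => by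
    simp only [σ]
    split_ifs with h
    · have : (i : ℝ) ≤ 2 := by exact_mod_cast h
      rw [div_le_iff₀ (by linarith)]
      linarith
    · norm_num
  let x : Set.Icc (0 : ℝ) 1 → ℝ := Subtype.val
  have hx : ∀ y, 0 ≤ x y := fun y => y.2.1
  choose G hG0 hG hGe using fun i : ℕ => exists_core hw hn hm hmw (g := monotonized f (σ i))
    (fun _ _ h => sub_nonneg.1 (monotonized_sub hf _ h).1)
    (fun _ _ h => (monotonized_sub hf _ h).2) (fun u => (monotonized_mem hf _ u).1)
    (fun u => (monotonized_mem hf _ u).2) (fun y => (x y + σ i) / 2)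
    (fun y => by have := hx y; have := hσ i; positivity)
  obtain ⟨Φ, h1, h2, h3, h4⟩ := Computes.exists_unit_weight_net (w₀ := w) (by lia) (by lia)
    hx (fun _ => le_max_right _ _) (-1) (by simp)
    (computes_median (by lia) (pow_six_bounds hw).2.2 x (G 0) (G 1) (G 2) hx (hG0 0) (hG0 1)
      (hG0 2) σ hσ hσ' (hG 0) (hG 1) (hG 2))
  refine ⟨Φ, h1, by lia, h3, fun t ht => ?_⟩
  have e := h4 ⟨t, ht⟩
  simp only [x] at e
  rw [e]
  have hmed : |median (G 0 ⟨t, ht⟩) (G 1 ⟨t, ht⟩) (G 2 ⟨t, ht⟩) - (f t + t + 2) / 8|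
      ≤ 2 / (n * w ^ 2 * (n * m)) := by
    refine abs_median_sub_le (exists_two_shifts (z := M * t / 2) (p := fun i =>
      i ≤ 2 → |G i ⟨t, ht⟩ - (f t + t + 2) / 8| ≤ 2 / (n * w ^ 2 * (n * m))) ?_ ?_ |>.imp
      ?_ (Or.imp ?_ ?_))
    · have := ht.1
      positivity
    · intro i c hc hl hr hi
      have e' : n * (w : ℝ) ^ 2 * ((t + σ i) / 2) = M * t / 2 + i / 3 := by
        simp only [σ, if_pos hi, ← hM]
        field_simp
      have key := hGe i ⟨t, ht⟩ c ?_ (by simpa only [x, e'] using hl)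
        (by simpa only [x, e'] using hr)
      · rwa [monotonized_shift f _ ht] at key
      · have : (c : ℝ) < ((n * w ^ 2 : ℕ) : ℝ) := by
          push_cast
          nlinarith [ht.2]
        exact_mod_cast this
    · exact fun h => ⟨h.1 (by lia), h.2 (by lia)⟩
    · exact fun h => ⟨h.1 (by lia), h.2 (by lia)⟩
    · exact fun h => ⟨h.1 (by lia), h.2 (by lia)⟩
  have hft := (abs_le.1 (hf.2.1 t ht)).1
  have e16 : 16 / (n * w ^ 2 * (n * m) : ℝ) = 8 * (2 / (n * w ^ 2 * (n * m))) := by ring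
  rw [e16]
  rw [abs_le] at hmed ⊢
  rcases max_cases (8 * median (G 0 ⟨t, ht⟩) (G 1 ⟨t, ht⟩) (G 2 ⟨t, ht⟩) - t - 1) 0 with
    ⟨e, _⟩ | ⟨e, _⟩ <;> rw [e] <;> constructor <;> linarith [hmed.1, hmed.2]

theorem minimax_parameters {W L : ℕ} (hW : 100000 ≤ W) (hL : 100000 ≤ L) :
    ∃ w n m : ℕ, 64 ≤ w ∧ 1 ≤ n ∧ 1 ≤ m ∧ 2 ^ m ≤ w ∧ 60 * w ≤ W ∧ 300 * n ≤ L ∧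
      16 / (n * (w : ℝ) ^ 2 * (n * m)) ≤
        16 * 120 ^ 2 * 600 ^ 2 * 2 * ((W : ℝ) ^ 2 * (L : ℝ) ^ 2 * Real.logb 2 W)⁻¹ := by
  obtain ⟨w, hw⟩ : ∃ w, w = W / 60 := ⟨_, rfl⟩
  obtain ⟨n, hn⟩ : ∃ n, n = L / 300 := ⟨_, rfl⟩
  obtain ⟨m, hm⟩ : ∃ m, m = Nat.log 2 w := ⟨_, rfl⟩
  have hm1 : 2 ^ m ≤ w := hm ▸ Nat.pow_log_le_self 2 (by lia)
  have hm2 : w < 2 ^ (m + 1) := hm ▸ Nat.lt_pow_succ_log_self one_lt_two w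
  have hm8 : 8 ≤ m := hm ▸ Nat.le_log_of_pow_le one_lt_two (by norm_num; lia)
  refine ⟨w, n, m, by lia, by lia, by lia, hm1, by lia, by lia, ?_⟩
  have h256 : 2 ^ 8 ≤ 2 ^ m := Nat.pow_le_pow_right two_pos hm8
  have hWm : W ≤ 2 ^ (2 * m) := by
    rw [pow_succ] at hm2
    calc W ≤ 2 ^ 8 * 2 ^ m := by lia
      _ ≤ 2 ^ m * 2 ^ m := Nat.mul_le_mul_right _ h256
      _ = 2 ^ (2 * m) := by ring
  have hlog : Real.logb 2 W ≤ 2 * m := by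
    rw [Real.logb_le_iff_le_rpow one_lt_two (by norm_cast; lia)]
    exact_mod_cast hWm
  have hlog0 : 0 < Real.logb 2 W := Real.logb_pos one_lt_two (by norm_cast; lia)
  have hWw : (W : ℝ) ≤ 120 * w := by norm_cast; lia
  have hLn : (L : ℝ) ≤ 600 * n := by norm_cast; lia
  have hW0 : (0 : ℝ) < W := by norm_cast; lia
  have hL0 : (0 : ℝ) < L := by norm_cast; lia
  have hw0 : (0 : ℝ) < w := by norm_cast; lia
  have hn0 : (0 : ℝ) < n := by norm_cast; lia
  have hm0 : (0 : ℝ) < m := by norm_cast; lia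
  rw [← div_eq_mul_inv, div_le_div_iff₀ (by positivity) (by positivity)]
  calc 16 * ((W : ℝ) ^ 2 * (L : ℝ) ^ 2 * Real.logb 2 W)
      ≤ 16 * ((120 * w) ^ 2 * (600 * n) ^ 2 * (2 * m)) := by gcongr
    _ = _ := by ring

theorem intervalDist_le {p : ℝ≥0∞} {f g : ℝ → ℝ} {ε : ℝ}
    (h : ∀ x ∈ Set.Icc (0 : ℝ) 1, |f x - g x| ≤ ε) : intervalDist p f g ≤ ENNReal.ofReal ε := by
  refine (eLpNorm_le_of_ae_bound (C := ε) ?_).trans ?_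
  · rw [ae_restrict_iff' measurableSet_Icc]
    exact Filter.Eventually.of_forall h
  · simp

end ReLUApprox

/-- Upper bound on the minimax error in approximating 1-Lipschitz
functions by deep ReLU networks with weights bounded by 1:
`A(H¹([0,1]), R(1,W,L,1), ‖·‖_{L^p([0,1])}) ≤ C (W²L² log W)⁻¹` for `W, L ≥ D`. -/
theorem lipschitz_approximation_upper_bound :
    ∃ C D : ℝ, 0 < C ∧ 0 < D ∧
      ∀ (W L : ℕ) (p : ℝ≥0∞),
        D ≤ (W : ℝ) → D ≤ (L : ℝ) → 1 ≤ p →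
        minimaxErr H1 (RclassB₁ W L 1) (intervalDist p)
          ≤ ENNReal.ofReal
              (C * ((W : ℝ) ^ 2 * (L : ℝ) ^ 2 * Real.logb 2 (W : ℝ))⁻¹) := by
  refine ⟨16 * 120 ^ 2 * 600 ^ 2 * 2, 100000, by norm_num, by norm_num, fun W L p hW hL _ => ?_⟩
  obtain ⟨w, n, m, hw, hn, hm, hmw, hwW, hnL, hε⟩ :=
    ReLUApprox.minimax_parameters (W := W) (L := L) (by exact_mod_cast hW) (by exact_mod_cast hL)
  refine iSup₂_le fun f hf => ?_
  obtain ⟨Φ, h1, h2, h3, h4⟩ := ReLUApprox.exists_net_of_mem_H1 hf hw hn hm hmw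
  refine iInf₂_le_of_le (toOneVar Φ.realization)
    ⟨_, ⟨Φ, fun i hi => (h1 i hi).trans hwW, h2.trans hnL, h3, rfl⟩, rfl⟩ ?_
  exact ReLUApprox.intervalDist_le fun x hx => (h4 x hx).trans hε
end
end
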